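/- Area control for cells: let p ∈ (1,∞), let m be a positive integer, let Ω ⊂ ℝ^N be an open bounded convex set, let φ be a positive (1/m)-concave weight in L¹(Ω), and let ū be a first eigenfunction for μ_p(Ω,φ) normalized so that ∫_Ω φ|ū|^p = 1. Set K₂ := 2^{−(N+m)}/(K_∞(N+m)^p·K_kroger(p,N+m)^{N+m}), where K_∞(k) := 2^{2k}·ω_k^{−1}·(1+4k^{k+1})^k·(k/(k−1))^{k(k−1)} and K_kroger(p,k) := (p+1)·2^{(k+3p)/2}·k^{k+p}. Then every cell ω of a φ-weighted L^p equipartition of ū in Ω into n cells satisfies |ω| ≥ K₂·|Ω|/n. -/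

import Mathlib

open MeasureTheory Set Filter Topology

/-- `π_p := 2π (p-1)^{1/p} / (p sin(π/p))`. -/
noncomputable def piP (p : ℝ) : ℝ :=
  2 * Real.pi * (p - 1) ^ (1 / p) / (p * Real.sin (Real.pi / p))

/-- The first nontrivial Neumann `p`-Laplacian eigenvalue of `Ω` with weight `φ`. -/
noncomputable def muP (p : ℝ) {N : ℕ} (Ω : Set (EuclideanSpace ℝ (Fin N)))
    (φ : EuclideanSpace ℝ (Fin N) → ℝ) : ℝ :=
  sInf { r : ℝ | ∃ (u : EuclideanSpace ℝ (Fin N) → ℝ) (K : NNReal),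
    LipschitzWith K u ∧
    ¬ (∀ᵐ x ∂(volume.restrict Ω), u x = 0) ∧
    (∫ x in Ω, φ x * |u x| ^ (p - 2) * u x) = 0 ∧
    r = (∫ x in Ω, φ x * ‖fderiv ℝ u x‖ ^ p) / (∫ x in Ω, φ x * |u x| ^ p) }

/-- A first eigenfunction for `μ_p(Ω,φ)`: a locally Lipschitz (on `Ω`) function, not a.e.
zero, with `∫_Ω φ |u|^{p-2} u = 0`, finite weighted energy and `p`-norm, realizing the
infimum: `∫_Ω φ |∇u|^p = μ_p(Ω,φ) ∫_Ω φ |u|^p`. -/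
def IsFirstEigenfunction (p : ℝ) {N : ℕ} (Ω : Set (EuclideanSpace ℝ (Fin N)))
    (φ : EuclideanSpace ℝ (Fin N) → ℝ) (u : EuclideanSpace ℝ (Fin N) → ℝ) : Prop :=
  (∀ x ∈ Ω, ∃ (K : NNReal) (t : Set (EuclideanSpace ℝ (Fin N))),
      t ∈ nhdsWithin x Ω ∧ LipschitzOnWith K u t) ∧
  ¬ (∀ᵐ x ∂(volume.restrict Ω), u x = 0) ∧
  IntegrableOn (fun x => φ x * |u x| ^ p) Ω volume ∧
  IntegrableOn (fun x => φ x * ‖fderiv ℝ u x‖ ^ p) Ω volume ∧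
  (∫ x in Ω, φ x * |u x| ^ (p - 2) * u x) = 0 ∧
  (∫ x in Ω, φ x * ‖fderiv ℝ u x‖ ^ p) = muP p Ω φ * ∫ x in Ω, φ x * |u x| ^ p

/-- The constant `K_∞(k) = 2^{2k} ω_k^{-1} (1+4k^{k+1})^k (k/(k-1))^{k(k-1)}`, where `ω_k`
is the volume of the unit ball of `ℝ^k`. -/
noncomputable def Kinf (k : ℕ) : ℝ :=
  2 ^ (2 * k) * ((volume (Metric.ball (0 : EuclideanSpace ℝ (Fin k)) 1)).toReal)⁻¹ *
    (1 + 4 * (k : ℝ) ^ (k + 1)) ^ k * ((k : ℝ) / ((k : ℝ) - 1)) ^ (k * (k - 1))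

/-- A positive function is `α`-concave on `Ω` if its `α`-th power is concave. -/
def IsAlphaConcaveOn {N : ℕ} (α : ℝ) (Ω : Set (EuclideanSpace ℝ (Fin N)))
    (φ : EuclideanSpace ℝ (Fin N) → ℝ) : Prop :=
  (∀ x ∈ Ω, 0 < φ x) ∧ ConcaveOn ℝ Ω fun x => φ x ^ α

/-- The Kröger-type constant `K_kroger(p,k) := (p+1) 2^{(k+3p)/2} k^{k+p}`. -/
noncomputable def Kkroger (p : ℝ) (k : ℕ) : ℝ :=
  (p + 1) * 2 ^ (((k : ℝ) + 3 * p) / 2) * (k : ℝ) ^ ((k : ℝ) + p)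

/-- The constant `K₂ := 2^{-(N+m)} / (K_∞(N+m)^p K_kroger(p,N+m)^{N+m})`, with `k = N+m`. -/
noncomputable def K2 (p : ℝ) (k : ℕ) : ℝ :=
  (1 / 2 ^ k) / (Kinf k ^ p * Kkroger p k ^ k)

/-- A `φ`-weighted `L^p` equipartition of `u` in `Ω` into `n` cells: mutually disjoint open
convex subsets covering `Ω` up to a null set, on each of which `φ|u|^{p-2}u` has zero
integral and `φ|u|^p` has integral `(1/n) ∫_Ω φ|u|^p`. -/
def IsLpEquipartition (p : ℝ) {N : ℕ} (Ω : Set (EuclideanSpace ℝ (Fin N)))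
    (φ u : EuclideanSpace ℝ (Fin N) → ℝ) (n : ℕ)
    (P : Fin n → Set (EuclideanSpace ℝ (Fin N))) : Prop :=
  (∀ i, IsOpen (P i)) ∧ (∀ i, Convex ℝ (P i)) ∧ (∀ i, P i ⊆ Ω) ∧
  Pairwise (Function.onFun Disjoint P) ∧
  volume (Ω \ ⋃ i, P i) = 0 ∧
  (∀ i, (∫ x in P i, φ x * |u x| ^ (p - 2) * u x) = 0) ∧
  (∀ i, (∫ x in P i, φ x * |u x| ^ p) = (1 / n) * ∫ x in Ω, φ x * |u x| ^ p)

open scoped ENNReal NNReal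

/-- Dilating towards `x` by a factor `t` decreases a `1/m`-concave weight by at most `t ^ m`. -/
theorem IsAlphaConcaveOn.pow_mul_le {N m : ℕ} (hm : 0 < m) {Ω : Set (EuclideanSpace ℝ (Fin N))}
    {φ : EuclideanSpace ℝ (Fin N) → ℝ} (hφ : IsAlphaConcaveOn (1 / m) Ω φ)
    {x y : EuclideanSpace ℝ (Fin N)} (hx : x ∈ Ω) (hy : y ∈ Ω) {t : ℝ} (ht0 : 0 ≤ t) (ht1 : t ≤ 1) :
    t ^ m * φ y ≤ φ ((1 - t) • x + t • y) := by
  obtain ⟨hpos, hconc⟩ := hφ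
  have hz : (1 - t) • x + t • y ∈ Ω := hconc.1 hx hy (by linarith) ht0 (by ring)
  have h := hconc.2 hx hy (by linarith : 0 ≤ 1 - t) ht0 (by ring)
  simp only [smul_eq_mul] at h
  have key : ∀ z ∈ Ω, (φ z ^ (1 / (m : ℝ))) ^ m = φ z := fun z hz => by
    rw [← Real.rpow_natCast, ← Real.rpow_mul (hpos z hz).le, one_div,
      inv_mul_cancel₀ (by positivity), Real.rpow_one]
  have hx' : 0 ≤ φ x ^ (1 / (m : ℝ)) := Real.rpow_nonneg (hpos x hx).le _
  have hy' : 0 ≤ φ y ^ (1 / (m : ℝ)) := Real.rpow_nonneg (hpos y hy).le _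
  calc t ^ m * φ y = (t * φ y ^ (1 / (m : ℝ))) ^ m := by rw [mul_pow, key y hy]
    _ ≤ (φ ((1 - t) • x + t • y) ^ (1 / (m : ℝ))) ^ m := by
        apply pow_le_pow_left₀ (by positivity)
        nlinarith
    _ = _ := key _ hz

theorem IsAlphaConcaveOn.continuousOn {N m : ℕ} (hm : 0 < m)
    {Ω : Set (EuclideanSpace ℝ (Fin N))} (hΩ : IsOpen Ω)
    {φ : EuclideanSpace ℝ (Fin N) → ℝ} (hφ : IsAlphaConcaveOn (1 / m) Ω φ) :
    ContinuousOn φ Ω := by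
  obtain ⟨hpos, hconc⟩ := hφ
  refine ((hconc.continuousOn hΩ).pow m).congr fun z hz => ?_
  show φ z = (φ z ^ (1 / (m : ℝ))) ^ m
  rw [← Real.rpow_natCast, ← Real.rpow_mul (hpos z hz).le, one_div,
    inv_mul_cancel₀ (by positivity), Real.rpow_one]

theorem lintegral_comp_add_smul {N : ℕ} (a : EuclideanSpace ℝ (Fin N)) {t : ℝ} (ht : 0 < t)
    {F : EuclideanSpace ℝ (Fin N) → ℝ≥0∞} (hF : Measurable F) :
    ∫⁻ y, F (a + t • y) = ENNReal.ofReal ((t ^ N)⁻¹) * ∫⁻ z, F z := by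
  have h1 := lintegral_map (μ := (volume : Measure (EuclideanSpace ℝ (Fin N))))
    (f := fun z => F (a + z)) (g := (t • ·)) (by fun_prop) (by fun_prop)
  rw [Measure.map_addHaar_smul volume ht.ne', lintegral_smul_measure,
    lintegral_add_left_eq_self F a, finrank_euclideanSpace_fin, abs_of_pos (by positivity)] at h1
  rw [← h1, smul_eq_mul]

/-- The measure with density `φ` on `Ω`. -/
noncomputable def weightedMeasure {N : ℕ} (Ω : Set (EuclideanSpace ℝ (Fin N)))
    (φ : EuclideanSpace ℝ (Fin N) → ℝ) : Measure (EuclideanSpace ℝ (Fin N)) :=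
  volume.withDensity (Ω.indicator fun x => ENNReal.ofReal (φ x))

/-- Dilations towards points of `Ω` by a factor `t` contract `ν`-integrals by at most `t ^ k`. -/
def HasContraction {N : ℕ} (Ω : Set (EuclideanSpace ℝ (Fin N)))
    (ν : Measure (EuclideanSpace ℝ (Fin N))) (k : ℕ) : Prop :=
  ∀ x ∈ Ω, ∀ t : ℝ, 0 < t → t ≤ 1 → ∀ g : EuclideanSpace ℝ (Fin N) → ℝ≥0∞, Measurable g →
    ∫⁻ y, g ((1 - t) • x + t • y) ∂ν ≤ ENNReal.ofReal ((t ^ k)⁻¹) * ∫⁻ z, g z ∂ν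

theorem measurable_indicator_ofReal {N : ℕ} {Ω : Set (EuclideanSpace ℝ (Fin N))}
    (hΩ : IsOpen Ω) {φ : EuclideanSpace ℝ (Fin N) → ℝ} (hc : ContinuousOn φ Ω) :
    Measurable (Ω.indicator fun x => ENNReal.ofReal (φ x)) := by
  have : (Ω.indicator fun x => ENNReal.ofReal (φ x)) =
      fun x => ENNReal.ofReal (Ω.indicator φ x) := by
    ext x
    by_cases hx : x ∈ Ω <;> simp [hx]
  classical
  rw [this, ← piecewise_eq_indicator]
  exact (hc.measurable_piecewise continuousOn_const hΩ.measurableSet).ennreal_ofReal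

theorem lintegral_weightedMeasure {N : ℕ} {Ω : Set (EuclideanSpace ℝ (Fin N))}
    (hΩ : IsOpen Ω) {φ : EuclideanSpace ℝ (Fin N) → ℝ} (hc : ContinuousOn φ Ω)
    {g : EuclideanSpace ℝ (Fin N) → ℝ≥0∞} :
    ∫⁻ x, g x ∂(weightedMeasure Ω φ) = ∫⁻ x in Ω, ENNReal.ofReal (φ x) * g x := by
  rw [weightedMeasure, lintegral_withDensity_eq_lintegral_mul_non_measurable _
    (measurable_indicator_ofReal hΩ hc)]
  · rw [← lintegral_indicator hΩ.measurableSet]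
    congr 1 with x
    by_cases hx : x ∈ Ω <;> simp [hx]
  · refine Eventually.of_forall fun x => ?_
    by_cases hx : x ∈ Ω <;> simp [hx]

theorem hasContraction_weightedMeasure {N m : ℕ} (hm : 0 < m)
    {Ω : Set (EuclideanSpace ℝ (Fin N))} (hΩ : IsOpen Ω) (hconv : Convex ℝ Ω)
    {φ : EuclideanSpace ℝ (Fin N) → ℝ} (hφ : IsAlphaConcaveOn (1 / m) Ω φ) :
    HasContraction Ω (weightedMeasure Ω φ) (N + m) := by
  intro x hx t ht0 ht1 g hg
  have hΦ := measurable_indicator_ofReal hΩ (hφ.continuousOn hm hΩ)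
  set Φ := Ω.indicator fun x => ENNReal.ofReal (φ x) with hΦdef
  rw [weightedMeasure, lintegral_withDensity_eq_lintegral_mul _ hΦ (by fun_prop),
    lintegral_withDensity_eq_lintegral_mul _ hΦ hg]
  have hpt : ∀ y, Φ y ≤ ENNReal.ofReal ((t ^ m)⁻¹) * Φ ((1 - t) • x + t • y) := by
    intro y
    by_cases hy : y ∈ Ω
    · have hz : (1 - t) • x + t • y ∈ Ω := hconv hx hy (by linarith) ht0.le (by ring)
      rw [hΦdef, indicator_of_mem hy, indicator_of_mem hz, ← ENNReal.ofReal_mul (by positivity)]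
      apply ENNReal.ofReal_le_ofReal
      rw [← div_eq_inv_mul, le_div_iff₀ (by positivity), mul_comm]
      exact hφ.pow_mul_le hm hx hy ht0.le ht1
    · simp [hΦdef, hy]
  calc ∫⁻ y, (Φ * fun y => g ((1 - t) • x + t • y)) y
      ≤ ∫⁻ y, ENNReal.ofReal ((t ^ m)⁻¹) * (Φ * g) ((1 - t) • x + t • y) := by
        apply lintegral_mono
        intro y
        simp only [Pi.mul_apply]
        rw [← mul_assoc]
        gcongr
        exact hpt y
    _ = ENNReal.ofReal ((t ^ (N + m))⁻¹) * ∫⁻ z, (Φ * g) z := by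
        rw [lintegral_const_mul _ (by fun_prop), lintegral_comp_add_smul _ ht0 (hΦ.mul hg),
          ← mul_assoc, ← ENNReal.ofReal_mul (by positivity), pow_add, mul_inv, mul_comm (t ^ m)⁻¹]

/-- The norm of the derivative, with the value `∞` where there is none. -/
noncomputable def gradNorm {N : ℕ} (f : EuclideanSpace ℝ (Fin N) → ℝ)
    (z : EuclideanSpace ℝ (Fin N)) : ℝ≥0∞ :=
  open Classical in if DifferentiableAt ℝ f z then ENNReal.ofReal ‖fderiv ℝ f z‖ else ∞

theorem measurable_gradNorm {N : ℕ} (f : EuclideanSpace ℝ (Fin N) → ℝ) : Measurable (gradNorm f) :=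
  Measurable.ite (measurableSet_of_differentiableAt ℝ f)
    (measurable_fderiv ℝ f).norm.ennreal_ofReal measurable_const

theorem LocallyLipschitzOn.ae_differentiableAt {N : ℕ} {Ω : Set (EuclideanSpace ℝ (Fin N))}
    (hΩ : IsOpen Ω) {f : EuclideanSpace ℝ (Fin N) → ℝ} (hf : LocallyLipschitzOn Ω f) :
    ∀ᵐ x, x ∈ Ω → DifferentiableAt ℝ f x := by
  have : volume {x | x ∈ Ω ∧ ¬ DifferentiableAt ℝ f x} = 0 := by
    apply measure_null_of_locally_null
    rintro x ⟨hx, -⟩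
    obtain ⟨K, t, ht, hKt⟩ := hf hx
    rw [hΩ.nhdsWithin_eq hx] at ht
    obtain ⟨s, hst, hs, hxs⟩ := mem_nhds_iff.1 ht
    refine ⟨s ∩ {x | x ∈ Ω ∧ ¬ DifferentiableAt ℝ f x},
      inter_mem (mem_nhdsWithin_of_mem_nhds (hs.mem_nhds hxs)) self_mem_nhdsWithin, ?_⟩
    have := (hKt.mono hst).ae_differentiableWithinAt_of_mem (μ := volume)
    refine measure_mono_null ?_ this
    rintro y ⟨hys, -, hy⟩ h
    exact hy ((h hys).differentiableAt (hs.mem_nhds hys))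
  rw [ae_iff]
  simpa using this

theorem enorm_sub_le_lintegral_gradNorm {N : ℕ} {Ω : Set (EuclideanSpace ℝ (Fin N))}
    (hconv : Convex ℝ Ω) {f : EuclideanSpace ℝ (Fin N) → ℝ}
    (hf : LocallyLipschitzOn Ω f) {x y : EuclideanSpace ℝ (Fin N)} (hx : x ∈ Ω) (hy : y ∈ Ω) :
    ENNReal.ofReal |f x - f y| ≤
      ENNReal.ofReal ‖x - y‖ * ∫⁻ t in Ioo (0 : ℝ) 1, gradNorm f ((1 - t) • x + t • y) := by
  rcases eq_or_ne x y with rfl | hxy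
  · simp
  have hpos : 0 < ‖x - y‖ := norm_pos_iff.2 (sub_ne_zero.2 hxy)
  set γ : ℝ → EuclideanSpace ℝ (Fin N) := fun t => (1 - t) • x + t • y with hγ
  have hγc : Continuous γ := by fun_prop
  by_cases hae : ∀ᵐ t ∂(volume.restrict (Ioo (0 : ℝ) 1)), DifferentiableAt ℝ f (γ t)
  · have hγd : ∀ t, HasDerivAt γ (y - x) t := fun t => by
      have h1 : HasDerivAt (fun t : ℝ => (1 - t) • x) ((-1 : ℝ) • x) t :=
        ((hasDerivAt_id t).const_sub 1).smul_const x
      have h2 : HasDerivAt (fun t : ℝ => t • y) ((1 : ℝ) • y) t := (hasDerivAt_id t).smul_const y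
      convert! h1.add h2 using 1
      simp [sub_eq_neg_add]
    have hmaps : MapsTo γ (Icc 0 1) Ω := fun t ht =>
      hconv hx hy (by linarith [ht.2]) ht.1 (by ring)
    have hcomp : IsCompact (γ '' Icc 0 1) := isCompact_Icc.image hγc
    obtain ⟨K, hK⟩ := (hf.mono hmaps.image_subset).exists_lipschitzOnWith_of_compact hcomp
    have hγL : LipschitzWith ‖y - x‖₊ γ := by
      apply LipschitzWith.of_dist_le_mul
      intro s t
      rw [dist_eq_norm, hγ]
      have : (1 - s) • x + s • y - ((1 - t) • x + t • y) = (s - t) • (y - x) := by module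
      simp only [this, norm_smul, coe_nnnorm, Real.dist_eq, Real.norm_eq_abs]
      rw [mul_comm]
    have hLip : LipschitzOnWith (K * ‖y - x‖₊) (f ∘ γ) (uIcc 0 1) := by
      rw [uIcc_of_le zero_le_one]
      exact hK.comp hγL.lipschitzOnWith (mapsTo_image _ _)
    have hFTC := hLip.absolutelyContinuousOnInterval.integral_deriv_eq_sub
    have h01 : f x - f y = - ∫ t in (0 : ℝ)..1, deriv (f ∘ γ) t := by
      rw [hFTC]; simp [hγ]
    rw [h01, abs_neg, ← Real.norm_eq_abs, ofReal_norm, intervalIntegral.integral_of_le zero_le_one,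
      integral_Ioc_eq_integral_Ioo]
    refine (enorm_integral_le_lintegral_enorm _).trans ?_
    change _ ≤ _ * ∫⁻ t in Ioo (0 : ℝ) 1, gradNorm f (γ t)
    rw [← lintegral_const_mul _
      (show Measurable fun t => gradNorm f (γ t) from (measurable_gradNorm f).comp hγc.measurable)]
    apply lintegral_mono_ae
    filter_upwards [hae] with t ht
    have hd := (ht.hasFDerivAt.comp_hasDerivAt t (hγd t)).deriv
    rw [hd, gradNorm, if_pos ht, ← ENNReal.ofReal_mul (norm_nonneg _), ← ofReal_norm]
    apply ENNReal.ofReal_le_ofReal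
    rw [mul_comm, norm_sub_rev]
    exact ContinuousLinearMap.le_opNorm _ _
  · have htop : ∫⁻ t in Ioo (0 : ℝ) 1, gradNorm f (γ t) = ∞ := by
      by_contra hne
      apply hae
      filter_upwards [ae_lt_top ((measurable_gradNorm f).comp hγc.measurable) hne] with t ht
      by_contra hd
      simp [gradNorm, hd] at ht
    rw [htop, ENNReal.mul_top (by simpa using hpos)]
    exact le_top

theorem lintegral_Ioi_inv_pow_le {k : ℕ} (hk : 2 ≤ k) {τ : ℝ} (hτ : 0 < τ) :
    ∫⁻ t in Ioi τ, ENNReal.ofReal ((t ^ k)⁻¹) ≤ ENNReal.ofReal (τ * (τ ^ k)⁻¹) := by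
  have hk' : (2 : ℝ) ≤ k := by exact_mod_cast hk
  have hlt : -(k : ℝ) < -1 := by linarith
  have heq : ∀ t ∈ Ioi τ, ENNReal.ofReal ((t ^ k)⁻¹) = ENNReal.ofReal (t ^ (-(k : ℝ))) :=
    fun t ht => by rw [Real.rpow_neg (hτ.trans ht).le, Real.rpow_natCast]
  rw [setLIntegral_congr_fun measurableSet_Ioi heq,
    ← ofReal_integral_eq_lintegral_ofReal (integrableOn_Ioi_rpow_of_lt hlt hτ)
      ((ae_restrict_iff' measurableSet_Ioi).2 (Eventually.of_forall fun t ht =>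
        Real.rpow_nonneg (hτ.trans ht).le _)),
    integral_Ioi_rpow_of_lt hlt hτ]
  apply ENNReal.ofReal_le_ofReal
  rw [Real.rpow_add hτ, Real.rpow_neg hτ.le, Real.rpow_natCast, Real.rpow_one, neg_div,
    ← div_neg, neg_add, neg_neg, mul_comm]
  apply div_le_self (by positivity)
  linarith

theorem lintegral_rpow_le_rpow_lintegral {p : ℝ} (hp : 1 ≤ p) {G : ℝ → ℝ≥0∞}
    (hG : Measurable G) :
    (∫⁻ t in Ioo (0 : ℝ) 1, G t) ^ p ≤ ∫⁻ t in Ioo (0 : ℝ) 1, G t ^ p := by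
  rcases hp.eq_or_lt with rfl | hp
  · simp
  have hpq := Real.HolderConjugate.conjExponent hp
  have := ENNReal.lintegral_mul_le_Lp_mul_Lq (volume.restrict (Ioo (0 : ℝ) 1)) hpq
    hG.aemeasurable (g := fun _ => 1) aemeasurable_const
  simp only [Pi.mul_apply, mul_one, ENNReal.one_rpow, lintegral_const,
    Measure.restrict_apply MeasurableSet.univ, univ_inter, Real.volume_Ioo, sub_zero,
    ENNReal.ofReal_one] at this
  calc _ ≤ ((∫⁻ t in Ioo (0 : ℝ) 1, G t ^ p) ^ (1 / p)) ^ p :=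
        ENNReal.rpow_le_rpow this (by positivity)
    _ = _ := by rw [← ENNReal.rpow_mul, one_div, inv_mul_cancel₀ (by positivity), ENNReal.rpow_one]

/-- A Faber–Krahn type inequality: a function supported in a set of small measure is controlled
by its gradient, with a gain equal to the `1/k`-th power of the relative measure. -/
theorem setLIntegral_rpow_le_lintegral_gradNorm {N k : ℕ} (hk : 2 ≤ k)
    {Ω : Set (EuclideanSpace ℝ (Fin N))} (hΩ : MeasurableSet Ω) (hconv : Convex ℝ Ω)
    {ν : Measure (EuclideanSpace ℝ (Fin N))} [IsFiniteMeasure ν] (hνΩ : ν Ωᶜ = 0)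
    (hcon : HasContraction Ω ν k) {f : EuclideanSpace ℝ (Fin N) → ℝ}
    (hf : LocallyLipschitzOn Ω f) {A : Set (EuclideanSpace ℝ (Fin N))} (hA : MeasurableSet A)
    (hAΩ : A ⊆ Ω) (hfA : ∀ x ∈ Ω \ A, f x = 0) {τ : ℝ} (hτ : 0 < τ) (hτ2 : τ ≤ 1 / 2)
    (hνA : ν A ≤ ENNReal.ofReal (τ ^ k) * ν univ) {d : ℝ} (hd0 : 0 ≤ d)
    (hd : ∀ x ∈ Ω, ∀ y ∈ Ω, ‖x - y‖ ≤ d) {p : ℝ} (hp : 1 ≤ p) :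
    ∫⁻ x in A, ENNReal.ofReal (|f x| ^ p) ∂ν ≤
      ENNReal.ofReal (d ^ p * (4 / 3 * 2 ^ k * τ)) * ∫⁻ z, gradNorm f z ^ p ∂ν := by
  have hp0 : 0 < p := by linarith
  rcases eq_or_ne (ν univ) 0 with hV | hV
  · rw [Measure.measure_univ_eq_zero] at hV
    simp [hV]
  set G : EuclideanSpace ℝ (Fin N) → ℝ≥0∞ := fun z => gradNorm f z ^ p with hG
  have hGm : Measurable G := (measurable_gradNorm f).pow_const p
  set Z := Ω \ A with hZ
  have hZm : MeasurableSet Z := hΩ.diff hA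
  have hsplit : ν univ = ν A + ν Z := by
    rw [← measure_add_measure_compl hΩ, hνΩ, add_zero, hZ, measure_add_sdiff hA.nullMeasurableSet,
      union_eq_self_of_subset_left hAΩ]
  have hτk : τ ^ k ≤ 1 / 4 := by
    calc τ ^ k ≤ τ ^ 2 := pow_le_pow_of_le_one hτ.le (by linarith) hk
      _ ≤ 1 / 4 := by nlinarith
  have hVZ : ν univ ≤ ENNReal.ofReal (4 / 3) * ν Z := by
    have h1 : ν A ≤ ENNReal.ofReal (1 / 4) * ν univ :=
      hνA.trans (by gcongr)
    rw [← ENNReal.ofReal_toReal (measure_ne_top ν univ),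
      ← ENNReal.ofReal_toReal (measure_ne_top ν Z), ← ENNReal.ofReal_mul (by norm_num)]
    apply ENNReal.ofReal_le_ofReal
    have h2 := ENNReal.toReal_mono
      (ENNReal.mul_ne_top ENNReal.ofReal_ne_top (measure_ne_top ν _)) h1
    rw [ENNReal.toReal_mul, ENNReal.toReal_ofReal (by norm_num)] at h2
    have h3 : (ν univ).toReal = (ν A).toReal + (ν Z).toReal := by
      rw [hsplit, ENNReal.toReal_add (measure_ne_top _ _) (measure_ne_top _ _)]
    linarith
  have hZ0 : ν Z ≠ 0 := fun h => by
    rw [h, mul_zero] at hVZ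
    exact hV (le_antisymm hVZ zero_le)
  have hpt : ∀ x ∈ A, ∀ y ∈ Z, ENNReal.ofReal (|f x| ^ p) ≤
      ENNReal.ofReal (d ^ p) * ∫⁻ t in Ioo (0 : ℝ) 1, G ((1 - t) • x + t • y) := by
    intro x hx y hy
    have h := enorm_sub_le_lintegral_gradNorm hconv hf (hAΩ hx) hy.1
    rw [hfA y hy, sub_zero] at h
    rw [← ENNReal.ofReal_rpow_of_nonneg (abs_nonneg _) hp0.le,
      ← ENNReal.ofReal_rpow_of_nonneg hd0 hp0.le]
    calc ENNReal.ofReal |f x| ^ p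
        ≤ (ENNReal.ofReal d * ∫⁻ t in Ioo (0 : ℝ) 1, gradNorm f ((1 - t) • x + t • y)) ^ p := by
          gcongr
          exact h.trans (by gcongr; exact hd x (hAΩ hx) y hy.1)
      _ ≤ _ := by
          rw [ENNReal.mul_rpow_of_nonneg _ _ hp0.le]
          gcongr
          exact lintegral_rpow_le_rpow_lintegral hp
            ((measurable_gradNorm f).comp (by fun_prop))
  set I : ℝ → ℝ≥0∞ := fun t => ∫⁻ x in A, ∫⁻ y in Z, G ((1 - t) • x + t • y) ∂ν ∂ν with hI
  have hI1 : ∀ t ∈ Ioo (0 : ℝ) 1,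
      I t ≤ ENNReal.ofReal ((t ^ k)⁻¹) * (∫⁻ z, G z ∂ν) * ν A := by
    intro t ht
    calc I t ≤ ∫⁻ x in A, ENNReal.ofReal ((t ^ k)⁻¹) * (∫⁻ z, G z ∂ν) ∂ν := by
          apply setLIntegral_mono' hA
          intro x hx
          exact (setLIntegral_le_lintegral _ _).trans (hcon x (hAΩ hx) t ht.1 ht.2.le G hGm)
      _ = _ := by rw [setLIntegral_const]
  have hI2 : ∀ t ∈ Ioo (0 : ℝ) 1,
      I t ≤ ENNReal.ofReal (((1 - t) ^ k)⁻¹) * (∫⁻ z, G z ∂ν) * ν Z := by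
    intro t ht
    rw [hI]
    simp only
    rw [lintegral_lintegral_swap (by
      apply Measurable.aemeasurable
      exact hGm.comp (by fun_prop))]
    calc _ ≤ ∫⁻ x in Z, ENNReal.ofReal (((1 - t) ^ k)⁻¹) * (∫⁻ z, G z ∂ν) ∂ν := by
          apply setLIntegral_mono' hZm
          intro y hy
          refine (setLIntegral_le_lintegral _ _).trans ?_
          have := hcon y hy.1 (1 - t) (by linarith [ht.2]) (by linarith [ht.1]) G hGm
          simpa only [sub_sub_cancel, add_comm] using this
      _ = _ := by rw [setLIntegral_const]
  have hmain : ν Z * ∫⁻ x in A, ENNReal.ofReal (|f x| ^ p) ∂ν ≤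
      ENNReal.ofReal (d ^ p) * ∫⁻ t in Ioo (0 : ℝ) 1, I t := by
    calc ν Z * ∫⁻ x in A, ENNReal.ofReal (|f x| ^ p) ∂ν
        = ∫⁻ x in A, ∫⁻ y in Z, ENNReal.ofReal (|f x| ^ p) ∂ν ∂ν := by
          simp_rw [setLIntegral_const]
          rw [lintegral_mul_const' _ _ (measure_ne_top ν Z), mul_comm]
      _ ≤ ∫⁻ x in A, ∫⁻ y in Z,
            ENNReal.ofReal (d ^ p) *
              (∫⁻ t in Ioo (0 : ℝ) 1, G ((1 - t) • x + t • y)) ∂ν ∂ν := by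
          apply setLIntegral_mono' hA
          intro x hx
          apply setLIntegral_mono' hZm
          intro y hy
          exact hpt x hx y hy
      _ = ENNReal.ofReal (d ^ p) *
            ∫⁻ x in A, ∫⁻ y in Z, (∫⁻ t in Ioo (0 : ℝ) 1, G ((1 - t) • x + t • y)) ∂ν ∂ν := by
          simp_rw [lintegral_const_mul' _ _ ENNReal.ofReal_ne_top]
      _ = ENNReal.ofReal (d ^ p) * ∫⁻ x in A, (∫⁻ t in Ioo (0 : ℝ) 1, ∫⁻ y in Z,
            G ((1 - t) • x + t • y) ∂ν) ∂ν := by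
          congr 2 with x
          exact lintegral_lintegral_swap (hGm.comp (by fun_prop)).aemeasurable
      _ = ENNReal.ofReal (d ^ p) * ∫⁻ t in Ioo (0 : ℝ) 1, I t := by
          congr 1
          apply lintegral_lintegral_swap
          apply Measurable.aemeasurable
          apply Measurable.lintegral_prod_right' (ν := ν.restrict Z)
            (f := fun q : (EuclideanSpace ℝ (Fin N) × ℝ) × EuclideanSpace ℝ (Fin N) =>
              G ((1 - q.1.2) • q.1.1 + q.1.2 • q.2))
          exact hGm.comp (by fun_prop)
  have hIint : ∫⁻ t in Ioo (0 : ℝ) 1, I t ≤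
      ν Z * (ENNReal.ofReal (4 / 3 * 2 ^ k * τ) * ∫⁻ z, G z ∂ν) := by
    have hJ1 : ∫⁻ t in Ioc (0 : ℝ) τ, I t ≤
        ENNReal.ofReal (2 ^ k * τ) * (∫⁻ z, G z ∂ν) * ν Z := by
      calc ∫⁻ t in Ioc (0 : ℝ) τ, I t
          ≤ ∫⁻ t in Ioc (0 : ℝ) τ, ENNReal.ofReal (2 ^ k) * (∫⁻ z, G z ∂ν) * ν Z := by
            apply setLIntegral_mono' measurableSet_Ioc
            intro t ht
            refine (hI2 t ⟨ht.1, by linarith [ht.2]⟩).trans ?_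
            gcongr
            rw [← inv_pow]
            have h1 : (1 : ℝ) / 2 ≤ 1 - t := by linarith [ht.2]
            gcongr
            rw [inv_le_comm₀ (by linarith) (by norm_num)]
            linarith
        _ = _ := by
            rw [setLIntegral_const, Real.volume_Ioc, sub_zero, ENNReal.ofReal_mul (by positivity)]
            ring
    have hJ2 : ∫⁻ t in Ioo τ 1, I t ≤
        ENNReal.ofReal (4 / 3 * τ) * (∫⁻ z, G z ∂ν) * ν Z := by
      calc ∫⁻ t in Ioo τ 1, I t
          ≤ ∫⁻ t in Ioo τ 1, ENNReal.ofReal ((t ^ k)⁻¹) * ((∫⁻ z, G z ∂ν) * ν A) := by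
            apply setLIntegral_mono' measurableSet_Ioo
            intro t ht
            refine (hI1 t ⟨hτ.trans ht.1, ht.2⟩).trans (le_of_eq (mul_assoc _ _ _))
        _ ≤ ENNReal.ofReal (τ * (τ ^ k)⁻¹) * ((∫⁻ z, G z ∂ν) * ν A) := by
            rw [lintegral_mul_const _ (by fun_prop)]
            gcongr
            exact (lintegral_mono_set Ioo_subset_Ioi_self).trans (lintegral_Ioi_inv_pow_le hk hτ)
        _ ≤ ENNReal.ofReal (τ * (τ ^ k)⁻¹) * ((∫⁻ z, G z ∂ν) *
              (ENNReal.ofReal (τ ^ k) * (ENNReal.ofReal (4 / 3) * ν Z))) := by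
            gcongr
            exact hνA.trans (by gcongr)
        _ = _ := by
            have : (4 / 3 * τ) = (τ * (τ ^ k)⁻¹) * τ ^ k * (4 / 3) := by
              field_simp
            rw [this, ENNReal.ofReal_mul (p := τ * (τ ^ k)⁻¹ * τ ^ k) (by positivity),
              ENNReal.ofReal_mul (p := τ * (τ ^ k)⁻¹) (by positivity)]
            generalize ENNReal.ofReal (τ * (τ ^ k)⁻¹) = c
            ring
    have hun : Ioo (0 : ℝ) 1 = Ioc 0 τ ∪ Ioo τ 1 :=
      (Ioc_union_Ioo_eq_Ioo hτ.le (by linarith)).symm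
    calc ∫⁻ t in Ioo (0 : ℝ) 1, I t ≤
        (∫⁻ t in Ioc (0 : ℝ) τ, I t) + ∫⁻ t in Ioo τ 1, I t := by
          rw [hun]; exact lintegral_union_le _ _ _
      _ ≤ _ := add_le_add hJ1 hJ2
      _ = ν Z * ((ENNReal.ofReal (2 ^ k * τ) + ENNReal.ofReal (4 / 3 * τ)) * ∫⁻ z, G z ∂ν) := by
          ring
      _ ≤ _ := by
          gcongr
          rw [← ENNReal.ofReal_add (by positivity) (by positivity)]
          apply ENNReal.ofReal_le_ofReal
          have : (2 : ℝ) ^ 2 ≤ 2 ^ k := pow_le_pow_right₀ (by norm_num) hk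
          nlinarith
  refine (ENNReal.mul_le_mul_iff_right hZ0 (measure_ne_top ν Z)).1 (hmain.trans ?_)
  calc _ ≤ ENNReal.ofReal (d ^ p) *
        (ν Z * (ENNReal.ofReal (4 / 3 * 2 ^ k * τ) * ∫⁻ z, G z ∂ν)) := by gcongr
    _ = _ := by
      rw [ENNReal.ofReal_mul (p := d ^ p) (by positivity)]
      generalize ENNReal.ofReal (4 / 3 * 2 ^ k * τ) = c
      ring

theorem abs_rpow_sub_two_mul_self {p : ℝ} (hp : 1 < p) (x : ℝ) :
    |(|x| ^ (p - 2) * x)| = |x| ^ (p - 1) := by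
  rcases eq_or_ne x 0 with rfl | hx
  · simp [Real.zero_rpow (by linarith : p - 1 ≠ 0)]
  · rw [abs_mul, abs_of_nonneg (by positivity)]
    nth_rw 2 [← Real.rpow_one |x|]
    rw [← Real.rpow_add (abs_pos.2 hx)]
    congr 1
    ring

theorem abs_rpow_sub_one_mul_abs {p : ℝ} (hp : 1 < p) (x : ℝ) :
    |x| ^ (p - 1) * |x| = |x| ^ p := by
  rcases eq_or_ne x 0 with rfl | hx
  · simp [Real.zero_rpow (by linarith : p ≠ 0)]
  · nth_rw 2 [← Real.rpow_one |x|]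
    rw [← Real.rpow_add (abs_pos.2 hx)]
    congr 1
    ring

theorem abs_rpow_sub_two_mul_sq {p : ℝ} (hp : 1 < p) (x : ℝ) :
    |x| ^ (p - 2) * x * x = |x| ^ p := by
  have h : 0 ≤ |x| ^ (p - 2) * x * x := by
    rw [mul_assoc]
    exact mul_nonneg (Real.rpow_nonneg (abs_nonneg _) _) (mul_self_nonneg x)
  rw [← abs_rpow_sub_one_mul_abs hp, ← abs_rpow_sub_two_mul_self hp, ← abs_mul, abs_of_nonneg h]

theorem continuous_abs_rpow_sub_two_mul_self {p : ℝ} (hp : 1 < p) :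
    Continuous fun x : ℝ => |x| ^ (p - 2) * x := by
  rw [continuous_iff_continuousAt]
  intro x
  rcases eq_or_ne x 0 with rfl | hx
  · rw [ContinuousAt, mul_zero, tendsto_zero_iff_norm_tendsto_zero]
    simp only [Real.norm_eq_abs, abs_rpow_sub_two_mul_self hp]
    have : Continuous fun x : ℝ => |x| ^ (p - 1) :=
      continuous_abs.rpow_const fun _ => Or.inr (by linarith)
    simpa [Real.zero_rpow (by linarith : p - 1 ≠ 0)] using this.tendsto 0
  · exact (continuous_abs.continuousAt.rpow_const (Or.inl (abs_ne_zero.2 hx))).mul continuousAt_id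

/-- Convexity of `|·| ^ p`: the graph lies above its tangents. -/
theorem abs_rpow_add_le_abs_rpow {p : ℝ} (hp : 1 < p) (x y : ℝ) :
    |x| ^ p + p * (|x| ^ (p - 2) * x) * (y - x) ≤ |y| ^ p := by
  have hpq := Real.HolderConjugate.conjExponent hp
  have hp0 : 0 < p := by linarith
  have hY := Real.young_inequality_of_nonneg (abs_nonneg y)
    (Real.rpow_nonneg (abs_nonneg x) (p - 1)) hpq
  have hq : (|x| ^ (p - 1)) ^ p.conjExponent = |x| ^ p := by
    rw [← Real.rpow_mul (abs_nonneg x), hpq.sub_one_mul_conj]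
  have h1 : |x| ^ (p - 2) * x * y ≤ |y| * |x| ^ (p - 1) := by
    rw [← abs_rpow_sub_two_mul_self hp, mul_comm |y|, ← abs_mul]
    exact le_abs_self _
  have h2 := abs_rpow_sub_two_mul_sq hp x
  have hq' : |x| ^ p / p.conjExponent = |x| ^ p * (1 - 1 / p) := by
    rw [div_eq_mul_inv, ← hpq.one_sub_inv, one_div]
  rw [hq, hq'] at hY
  have h3 : p * (|x| ^ (p - 2) * x * y) ≤ p * (|y| ^ p / p + |x| ^ p * (1 - 1 / p)) := by
    gcongr
    exact h1.trans hY
  have h4 : p * (|y| ^ p / p + |x| ^ p * (1 - 1 / p)) = |y| ^ p + (p - 1) * |x| ^ p := by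
    field_simp
  nlinarith

theorem muP_nonneg {N : ℕ} (p : ℝ) {Ω : Set (EuclideanSpace ℝ (Fin N))}
    (hΩ : MeasurableSet Ω) {φ : EuclideanSpace ℝ (Fin N) → ℝ} (hφ : ∀ x ∈ Ω, 0 ≤ φ x) :
    0 ≤ muP p Ω φ := by
  apply Real.sInf_nonneg
  rintro r ⟨u, K, -, -, -, rfl⟩
  exact div_nonneg
    (setIntegral_nonneg hΩ fun x hx => mul_nonneg (hφ x hx) (Real.rpow_nonneg (norm_nonneg _) _))
    (setIntegral_nonneg hΩ fun x hx => mul_nonneg (hφ x hx) (Real.rpow_nonneg (abs_nonneg _) _))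

theorem muP_mul_le {N : ℕ} {p : ℝ} (hp : 1 < p) {Ω : Set (EuclideanSpace ℝ (Fin N))}
    (hΩ : MeasurableSet Ω) {φ : EuclideanSpace ℝ (Fin N) → ℝ} (hφ : ∀ x ∈ Ω, 0 ≤ φ x)
    {w : EuclideanSpace ℝ (Fin N) → ℝ} {K : ℝ≥0} (hw : LipschitzWith K w)
    (h0 : ∫ x in Ω, φ x * |w x| ^ (p - 2) * w x = 0) :
    muP p Ω φ * ∫ x in Ω, φ x * |w x| ^ p ≤ ∫ x in Ω, φ x * ‖fderiv ℝ w x‖ ^ p := by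
  have hE : 0 ≤ ∫ x in Ω, φ x * ‖fderiv ℝ w x‖ ^ p :=
    setIntegral_nonneg hΩ fun x hx => mul_nonneg (hφ x hx) (Real.rpow_nonneg (norm_nonneg _) _)
  have hD : 0 ≤ ∫ x in Ω, φ x * |w x| ^ p :=
    setIntegral_nonneg hΩ fun x hx => mul_nonneg (hφ x hx) (Real.rpow_nonneg (abs_nonneg _) _)
  rcases hD.eq_or_lt with hD | hD
  · rw [← hD, mul_zero]; exact hE
  rw [← le_div_iff₀ hD]
  apply csInf_le
  · refine ⟨0, ?_⟩
    rintro r ⟨u, K, -, -, -, rfl⟩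
    exact div_nonneg
      (setIntegral_nonneg hΩ fun x hx => mul_nonneg (hφ x hx) (Real.rpow_nonneg (norm_nonneg _) _))
      (setIntegral_nonneg hΩ fun x hx => mul_nonneg (hφ x hx) (Real.rpow_nonneg (abs_nonneg _) _))
  · refine ⟨w, K, hw, fun hae => hD.ne' ?_, h0, rfl⟩
    apply integral_eq_zero_of_ae
    filter_upwards [hae] with x hx
    simp [hx, Real.zero_rpow (by linarith : p ≠ 0)]

theorem exists_const_integral_eq_zero {N : ℕ} {p : ℝ} (hp : 1 < p)
    {Ω : Set (EuclideanSpace ℝ (Fin N))} (hΩ : MeasurableSet Ω)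
    {φ : EuclideanSpace ℝ (Fin N) → ℝ} (hφ : ∀ x ∈ Ω, 0 ≤ φ x) (hφL : IntegrableOn φ Ω)
    {w : EuclideanSpace ℝ (Fin N) → ℝ} (hw : Continuous w) {M : ℝ} (hM : ∀ x ∈ Ω, |w x| ≤ M) :
    ∃ c, ∫ x in Ω, φ x * |w x - c| ^ (p - 2) * (w x - c) = 0 := by
  rcases Ω.eq_empty_or_nonempty with rfl | ⟨x₀, hx₀⟩
  · exact ⟨0, by simp⟩
  have hM0 : 0 ≤ M := (abs_nonneg _).trans (hM x₀ hx₀)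
  have hψ := continuous_abs_rpow_sub_two_mul_self hp
  set F : ℝ → ℝ := fun c => ∫ x in Ω, φ x * |w x - c| ^ (p - 2) * (w x - c) with hF
  have hcont : ContinuousOn F (Icc (-M) M) := by
    apply continuousOn_of_dominated (bound := fun x => φ x * (2 * M) ^ (p - 1))
    · intro c _
      simp_rw [mul_assoc]
      exact hφL.aestronglyMeasurable.mul
        (hψ.comp (hw.sub continuous_const)).aestronglyMeasurable
    · intro c hc
      filter_upwards [ae_restrict_mem hΩ] with x hx
      rw [mul_assoc, norm_mul, Real.norm_eq_abs, Real.norm_eq_abs, abs_rpow_sub_two_mul_self hp,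
        abs_of_nonneg (hφ x hx)]
      have h1 := abs_le.1 (hM x hx)
      have := hφ x hx
      gcongr
      rw [abs_le]
      constructor <;> linarith [hc.1, hc.2]
    · exact hφL.mul_const _
    · refine Eventually.of_forall fun x => ?_
      simp_rw [mul_assoc]
      exact (continuous_const.mul (hψ.comp (continuous_const.sub continuous_id))).continuousOn
  have hle : F M ≤ 0 := by
    apply setIntegral_nonpos hΩ
    intro x hx
    rw [mul_assoc]
    apply mul_nonpos_of_nonneg_of_nonpos (hφ x hx)
    apply mul_nonpos_of_nonneg_of_nonpos (Real.rpow_nonneg (abs_nonneg _) _)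
    linarith [(abs_le.1 (hM x hx)).2]
  have hge : 0 ≤ F (-M) := by
    apply setIntegral_nonneg hΩ
    intro x hx
    rw [mul_assoc]
    apply mul_nonneg (hφ x hx)
    apply mul_nonneg (Real.rpow_nonneg (abs_nonneg _) _)
    linarith [(abs_le.1 (hM x hx)).1]
  obtain ⟨c, -, hc⟩ := intermediate_value_Icc' (by linarith) hcont ⟨hle, hge⟩
  exact ⟨c, hc⟩

theorem rpow_sub_one_le {p : ℝ} (hp : 1 < p) {a : ℝ} (ha : 0 ≤ a) : a ^ (p - 1) ≤ 1 + a ^ p := by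
  rcases le_total a 1 with h | h
  · exact (Real.rpow_le_one ha h (by linarith)).trans (by linarith [Real.rpow_nonneg ha p])
  · exact (Real.rpow_le_rpow_of_exponent_le h (by linarith : p - 1 ≤ p)).trans (by linarith)

theorem integrableOn_weight_mul {N : ℕ} {p : ℝ} (hp : 1 < p)
    {Ω : Set (EuclideanSpace ℝ (Fin N))} (hΩ : MeasurableSet Ω)
    {φ : EuclideanSpace ℝ (Fin N) → ℝ} (hφ : ∀ x ∈ Ω, 0 ≤ φ x) (hφL : IntegrableOn φ Ω)
    {u : EuclideanSpace ℝ (Fin N) → ℝ} (hu : ContinuousOn u Ω)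
    (hup : IntegrableOn (fun x => φ x * |u x| ^ p) Ω) :
    IntegrableOn (fun x => φ x * (|u x| ^ (p - 2) * u x)) Ω := by
  refine (hφL.add hup).mono' (hφL.aestronglyMeasurable.mul
    (((continuous_abs_rpow_sub_two_mul_self hp).comp_continuousOn hu).aestronglyMeasurable hΩ)) ?_
  filter_upwards [ae_restrict_mem hΩ] with x hx
  rw [norm_mul, Real.norm_eq_abs, Real.norm_eq_abs, abs_rpow_sub_two_mul_self hp,
    abs_of_nonneg (hφ x hx), Pi.add_apply]
  nlinarith [mul_le_mul_of_nonneg_left (rpow_sub_one_le hp (abs_nonneg (u x))) (hφ x hx)]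

theorem muP_mul_sub_le_of_lipschitz {N : ℕ} {p : ℝ} (hp : 1 < p)
    {Ω : Set (EuclideanSpace ℝ (Fin N))} (hΩ : MeasurableSet Ω)
    {φ : EuclideanSpace ℝ (Fin N) → ℝ} (hφ : ∀ x ∈ Ω, 0 ≤ φ x) (hφL : IntegrableOn φ Ω)
    {u : EuclideanSpace ℝ (Fin N) → ℝ} (hu : ContinuousOn u Ω)
    (hup : IntegrableOn (fun x => φ x * |u x| ^ p) Ω)
    (hu0 : ∫ x in Ω, φ x * |u x| ^ (p - 2) * u x = 0)
    {w : EuclideanSpace ℝ (Fin N) → ℝ} {K : ℝ≥0} (hw : LipschitzWith K w)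
    {M : ℝ} (hM : ∀ x ∈ Ω, |w x| ≤ M) :
    muP p Ω φ * ((∫ x in Ω, φ x * |u x| ^ p) -
        p * ∫ x in Ω, φ x * (|u x| ^ (p - 2) * u x) * (u x - w x)) ≤
      ∫ x in Ω, φ x * ‖fderiv ℝ w x‖ ^ p := by
  obtain ⟨c, hc⟩ := exists_const_integral_eq_zero hp hΩ hφ hφL hw.continuous hM
  have hwc : LipschitzWith K fun x => w x - c := by
    intro x y
    simpa only [edist_sub_right] using hw x y
  have h := muP_mul_le hp hΩ hφ hwc hc
  simp only [fderiv_sub_const] at h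
  refine le_trans (mul_le_mul_of_nonneg_left ?_ (muP_nonneg p hΩ hφ)) h
  have hψu := integrableOn_weight_mul hp hΩ hφ hφL hu hup
  have hbd : ∀ᵐ x ∂(volume.restrict Ω), ‖w x‖ ≤ M := by
    filter_upwards [ae_restrict_mem hΩ] with x hx using hM x hx
  have hψw : IntegrableOn (fun x => φ x * (|u x| ^ (p - 2) * u x) * w x) Ω :=
    hψu.mul_bdd hw.continuous.aestronglyMeasurable hbd
  have hψuu : IntegrableOn (fun x => φ x * (|u x| ^ (p - 2) * u x) * u x) Ω := by
    refine hup.congr_fun (fun x _ => ?_) hΩ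
    simp only
    rw [mul_assoc, abs_rpow_sub_two_mul_sq hp]
  have hψd : IntegrableOn (fun x => φ x * (|u x| ^ (p - 2) * u x) * (u x - w x)) Ω := by
    simp_rw [mul_sub]
    exact hψuu.sub hψw
  have hwp : IntegrableOn (fun x => φ x * |w x - c| ^ p) Ω := by
    refine hφL.mul_bdd (c := (M + |c|) ^ p) ?_ ?_
    · exact ((hw.continuous.sub continuous_const).abs.rpow_const
        fun _ => Or.inr (by linarith)).aestronglyMeasurable
    · filter_upwards [ae_restrict_mem hΩ] with x hx
      rw [Real.norm_eq_abs, abs_of_nonneg (by positivity)]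
      gcongr
      exact (abs_sub _ _).trans (by linarith [hM x hx])
  have hu0' : ∫ x in Ω, φ x * (|u x| ^ (p - 2) * u x) = 0 := by
    simpa only [mul_assoc] using hu0
  have hsub : IntegrableOn (fun x => φ x * |u x| ^ p -
      p * (φ x * (|u x| ^ (p - 2) * u x) * (u x - w x))) Ω := hup.sub (hψd.const_mul p)
  have hsub' : IntegrableOn (fun x => φ x * |u x| ^ p -
      p * (φ x * (|u x| ^ (p - 2) * u x) * (u x - w x)) -
      p * c * (φ x * (|u x| ^ (p - 2) * u x))) Ω := hsub.sub (hψu.const_mul _)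
  calc (∫ x in Ω, φ x * |u x| ^ p) -
        p * ∫ x in Ω, φ x * (|u x| ^ (p - 2) * u x) * (u x - w x)
      = (∫ x in Ω, φ x * |u x| ^ p) -
        p * (∫ x in Ω, φ x * (|u x| ^ (p - 2) * u x) * (u x - w x)) -
        p * c * ∫ x in Ω, φ x * (|u x| ^ (p - 2) * u x) := by rw [hu0']; ring
    _ = ∫ x in Ω, (φ x * |u x| ^ p - p * (φ x * (|u x| ^ (p - 2) * u x) * (u x - w x)) -
        p * c * (φ x * (|u x| ^ (p - 2) * u x))) := by
        rw [integral_sub hsub (hψu.const_mul _),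
          integral_sub hup (hψd.const_mul p), integral_const_mul, integral_const_mul]
    _ ≤ ∫ x in Ω, φ x * |w x - c| ^ p := by
        apply setIntegral_mono_on hsub' hwp hΩ
        intro x hx
        have := mul_le_mul_of_nonneg_left (abs_rpow_add_le_abs_rpow hp (u x) (w x - c)) (hφ x hx)
        linarith

theorem lintegral_ofReal_weightedMeasure {N : ℕ} {Ω : Set (EuclideanSpace ℝ (Fin N))}
    (hΩ : IsOpen Ω) {φ : EuclideanSpace ℝ (Fin N) → ℝ} (hφ : ∀ x ∈ Ω, 0 ≤ φ x)
    (hc : ContinuousOn φ Ω) {g : EuclideanSpace ℝ (Fin N) → ℝ} (hg : ∀ x ∈ Ω, 0 ≤ g x)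
    (hφL : IntegrableOn (fun x => φ x * g x) Ω) :
    ∫⁻ x, ENNReal.ofReal (g x) ∂(weightedMeasure Ω φ) = ENNReal.ofReal (∫ x in Ω, φ x * g x) := by
  rw [lintegral_weightedMeasure hΩ hc, ofReal_integral_eq_lintegral_ofReal hφL]
  · refine setLIntegral_congr_fun hΩ.measurableSet fun x hx => ?_
    exact (ENNReal.ofReal_mul (hφ x hx)).symm
  · filter_upwards [ae_restrict_mem hΩ.measurableSet] with x hx
    exact mul_nonneg (hφ x hx) (hg x hx)

theorem setIntegral_weight_mul_le {N : ℕ} {Ω : Set (EuclideanSpace ℝ (Fin N))}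
    (hΩ : IsOpen Ω) {φ : EuclideanSpace ℝ (Fin N) → ℝ} (hφ : ∀ x ∈ Ω, 0 ≤ φ x)
    (hc : ContinuousOn φ Ω) {g : EuclideanSpace ℝ (Fin N) → ℝ} (hg : ∀ x ∈ Ω, 0 ≤ g x)
    {C : ℝ} (hC : 0 ≤ C)
    (h : ∫⁻ x, ENNReal.ofReal (g x) ∂(weightedMeasure Ω φ) ≤ ENNReal.ofReal C) :
    ∫ x in Ω, φ x * g x ≤ C := by
  by_cases hφL : IntegrableOn (fun x => φ x * g x) Ω
  · rw [lintegral_ofReal_weightedMeasure hΩ hφ hc hg hφL] at h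
    exact (ENNReal.ofReal_le_ofReal_iff hC).1 h
  · rwa [integral_undef hφL]

/-- Compressing towards an interior point turns a locally Lipschitz function into a Lipschitz
one. -/
theorem LocallyLipschitzOn.exists_lipschitzWith_eqOn {N : ℕ} {Ω : Set (EuclideanSpace ℝ (Fin N))}
    (hΩ : IsOpen Ω) (hconv : Convex ℝ Ω) (hbdd : Bornology.IsBounded Ω)
    {w : EuclideanSpace ℝ (Fin N) → ℝ} (hw : LocallyLipschitzOn Ω w)
    {x₀ : EuclideanSpace ℝ (Fin N)} (hx₀ : x₀ ∈ Ω) {t : ℝ} (ht0 : 0 < t) (ht1 : t < 1) :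
    ∃ (W : EuclideanSpace ℝ (Fin N) → ℝ) (K : ℝ≥0), LipschitzWith K W ∧
      EqOn W (fun x => w ((1 - t) • x₀ + t • x)) Ω := by
  have hcomp : IsCompact ((fun x => (1 - t) • x₀ + t • x) '' closure Ω) :=
    hbdd.isCompact_closure.image (by fun_prop)
  have hsub : (fun x => (1 - t) • x₀ + t • x) '' closure Ω ⊆ Ω := by
    rintro _ ⟨x, hx, rfl⟩
    have := hconv.combo_interior_closure_mem_interior (hΩ.interior_eq.symm ▸ hx₀) hx
      (by linarith : 0 < 1 - t) ht0.le (by ring)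
    rwa [hΩ.interior_eq] at this
  obtain ⟨K, hK⟩ := (hw.mono hsub).exists_lipschitzOnWith_of_compact hcomp
  have hh : LipschitzWith ‖t‖₊ fun x : EuclideanSpace ℝ (Fin N) => (1 - t) • x₀ + t • x := by
    refine LipschitzWith.of_dist_le_mul fun x y => ?_
    rw [dist_add_left, dist_smul₀, coe_nnnorm]
  have hL : LipschitzOnWith (K * ‖t‖₊) (fun x => w ((1 - t) • x₀ + t • x)) Ω :=
    hK.comp hh.lipschitzOnWith fun x hx => mem_image_of_mem _ (subset_closure hx)
  obtain ⟨W, hW, hWe⟩ := hL.extend_real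
  exact ⟨W, _, hW, hWe.symm⟩

theorem fderiv_comp_combo {N : ℕ} (w : EuclideanSpace ℝ (Fin N) → ℝ)
    (x₀ x : EuclideanSpace ℝ (Fin N)) (t : ℝ) :
    fderiv ℝ (fun x => w ((1 - t) • x₀ + t • x)) x = t • fderiv ℝ w ((1 - t) • x₀ + t • x) := by
  have h := fderiv_comp_smul (𝕜 := ℝ) (f := fun y => w ((1 - t) • x₀ + y)) (x := x) t
  rw [h, fderiv_comp_add_left]

theorem muP_mul_sub_le {N k : ℕ} {p : ℝ} (hp : 1 < p)
    {Ω : Set (EuclideanSpace ℝ (Fin N))} (hΩ : IsOpen Ω) (hconv : Convex ℝ Ω)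
    (hbdd : Bornology.IsBounded Ω) (hne : Ω.Nonempty)
    {φ : EuclideanSpace ℝ (Fin N) → ℝ} (hφ : ∀ x ∈ Ω, 0 ≤ φ x) (hφc : ContinuousOn φ Ω)
    (hφL : IntegrableOn φ Ω) (hcon : HasContraction Ω (weightedMeasure Ω φ) k)
    {u : EuclideanSpace ℝ (Fin N) → ℝ} (hu : ContinuousOn u Ω)
    (hup : IntegrableOn (fun x => φ x * |u x| ^ p) Ω)
    (hu0 : ∫ x in Ω, φ x * |u x| ^ (p - 2) * u x = 0)
    {w : EuclideanSpace ℝ (Fin N) → ℝ} (hw : LocallyLipschitzOn Ω w)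
    {M : ℝ} (hM : ∀ x ∈ Ω, |w x| ≤ M)
    (hE : IntegrableOn (fun x => φ x * ‖fderiv ℝ w x‖ ^ p) Ω) :
    muP p Ω φ * ((∫ x in Ω, φ x * |u x| ^ p) -
        p * ∫ x in Ω, φ x * (|u x| ^ (p - 2) * u x) * (u x - w x)) ≤
      ∫ x in Ω, φ x * ‖fderiv ℝ w x‖ ^ p := by
  obtain ⟨x₀, hx₀⟩ := hne
  have hp0 : 0 < p := by linarith
  have hΩm := hΩ.measurableSet
  set E := ∫ x in Ω, φ x * ‖fderiv ℝ w x‖ ^ p with hEdef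
  have hE0 : 0 ≤ E :=
    setIntegral_nonneg hΩm fun x hx => mul_nonneg (hφ x hx) (Real.rpow_nonneg (norm_nonneg _) _)
  have hmem : ∀ t : ℝ, 0 < t → t < 1 → ∀ x ∈ Ω, (1 - t) • x₀ + t • x ∈ Ω := fun t ht0 ht1 x hx =>
    hconv hx₀ hx (by linarith) ht0.le (by ring)
  have hstep : ∀ t : ℝ, 0 < t → t < 1 →
      muP p Ω φ * ((∫ x in Ω, φ x * |u x| ^ p) -
        p * ∫ x in Ω, φ x * (|u x| ^ (p - 2) * u x) * (u x - w ((1 - t) • x₀ + t • x))) ≤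
      (t ^ k)⁻¹ * E := by
    intro t ht0 ht1
    obtain ⟨W, K, hWL, hWe⟩ := hw.exists_lipschitzWith_eqOn hΩ hconv hbdd hx₀ ht0 ht1
    have h := muP_mul_sub_le_of_lipschitz hp hΩm hφ hφL hu hup hu0 hWL (M := M)
      (fun x hx => by rw [hWe hx]; exact hM _ (hmem t ht0 ht1 x hx))
    have hcongr : ∫ x in Ω, φ x * (|u x| ^ (p - 2) * u x) * (u x - W x) =
        ∫ x in Ω, φ x * (|u x| ^ (p - 2) * u x) * (u x - w ((1 - t) • x₀ + t • x)) :=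
      setIntegral_congr_fun hΩm fun x hx => by simp only [hWe hx]
    rw [hcongr] at h
    refine h.trans (setIntegral_weight_mul_le hΩ hφ hφc
      (fun x _ => Real.rpow_nonneg (norm_nonneg _) _) (mul_nonneg (by positivity) hE0) ?_)
    rw [ENNReal.ofReal_mul (by positivity), hEdef, ← lintegral_ofReal_weightedMeasure hΩ hφ hφc
      (fun x _ => Real.rpow_nonneg (norm_nonneg _) _) hE]
    refine le_trans ?_ (hcon x₀ hx₀ t ht0 ht1.le (fun z => ENNReal.ofReal (‖fderiv ℝ w z‖ ^ p))
      (((measurable_fderiv ℝ w).norm.pow_const p).ennreal_ofReal))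
    rw [lintegral_weightedMeasure hΩ hφc, lintegral_weightedMeasure hΩ hφc]
    refine setLIntegral_mono' hΩm fun x hx => ?_
    have hfd : fderiv ℝ W x = t • fderiv ℝ w ((1 - t) • x₀ + t • x) := by
      rw [← fderiv_comp_combo]
      exact (hWe.eventuallyEq_of_mem (hΩ.mem_nhds hx)).fderiv_eq
    gcongr
    rw [hfd, norm_smul, Real.norm_eq_abs, abs_of_pos ht0]
    exact mul_le_of_le_one_left (norm_nonneg _) ht1.le
  have hev : ∀ᶠ t in 𝓝[<] (1 : ℝ), 0 < t ∧ t < 1 :=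
    Ioo_mem_nhdsLT one_pos
  have hψu := integrableOn_weight_mul hp hΩm hφ hφL hu hup
  have hψuu : IntegrableOn (fun x => φ x * |u x| ^ (p - 1) * |u x|) Ω := by
    refine hup.congr_fun (fun x _ => ?_) hΩm
    simp only
    rw [mul_assoc, abs_rpow_sub_one_mul_abs hp]
  have hψu' : IntegrableOn (fun x => φ x * |u x| ^ (p - 1)) Ω := by
    refine IntegrableOn.congr_fun (f := fun x => ‖φ x * (|u x| ^ (p - 2) * u x)‖) hψu.norm
      (fun x hx => ?_) hΩm
    simp only
    rw [norm_mul, Real.norm_eq_abs, Real.norm_eq_abs, abs_rpow_sub_two_mul_self hp,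
      abs_of_nonneg (hφ x hx)]
  have hbd : IntegrableOn (fun x => φ x * |u x| ^ (p - 1) * (|u x| + M)) Ω := by
    simp_rw [mul_add]
    exact hψuu.add (hψu'.mul_const M)
  have hlim : Tendsto (fun t : ℝ => ∫ x in Ω, φ x * (|u x| ^ (p - 2) * u x) *
      (u x - w ((1 - t) • x₀ + t • x))) (𝓝[<] 1)
      (𝓝 (∫ x in Ω, φ x * (|u x| ^ (p - 2) * u x) * (u x - w x))) := by
    refine tendsto_integral_filter_of_dominated_convergence
      (fun x => φ x * |u x| ^ (p - 1) * (|u x| + M)) ?_ ?_ hbd ?_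
    · filter_upwards [hev] with t ht
      refine hψu.aestronglyMeasurable.mul ((hu.sub ?_).aestronglyMeasurable hΩm)
      exact hw.continuousOn.comp (by fun_prop) (hmem t ht.1 ht.2)
    · filter_upwards [hev] with t ht
      filter_upwards [ae_restrict_mem hΩm] with x hx
      rw [norm_mul, norm_mul, Real.norm_eq_abs, Real.norm_eq_abs, Real.norm_eq_abs,
        abs_rpow_sub_two_mul_self hp, abs_of_nonneg (hφ x hx)]
      have := hφ x hx
      gcongr
      exact (abs_sub _ _).trans (by gcongr; exact hM _ (hmem t ht.1 ht.2 x hx))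
    · filter_upwards [ae_restrict_mem hΩm] with x hx
      refine Tendsto.const_mul _ (Tendsto.const_sub _ ?_)
      have hc : ContinuousAt w x := hw.continuousOn.continuousAt (hΩ.mem_nhds hx)
      have h1 : Tendsto (fun t : ℝ => (1 - t) • x₀ + t • x) (𝓝[<] 1) (𝓝 x) := by
        have : Continuous fun t : ℝ => (1 - t) • x₀ + t • x := by fun_prop
        have h2 := this.tendsto 1
        simp only [sub_self, zero_smul, one_smul, zero_add] at h2
        exact h2.mono_left nhdsWithin_le_nhds
      exact hc.tendsto.comp h1
  have hlim2 : Tendsto (fun t : ℝ => (t ^ k)⁻¹ * E) (𝓝[<] 1) (𝓝 E) := by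
    have : ContinuousAt (fun t : ℝ => (t ^ k)⁻¹ * E) 1 := by
      fun_prop (disch := norm_num)
    have h2 := this.tendsto
    simp only [one_pow, inv_one, one_mul] at h2
    exact h2.mono_left nhdsWithin_le_nhds
  refine le_of_tendsto_of_tendsto ((hlim.const_mul p).const_sub _ |>.const_mul _) hlim2 ?_
  filter_upwards [hev] with t ht using hstep t ht.1 ht.2

theorem fderiv_max_min {N : ℕ} {Ω : Set (EuclideanSpace ℝ (Fin N))} (hΩ : IsOpen Ω)
    {u : EuclideanSpace ℝ (Fin N) → ℝ} (hu : ContinuousOn u Ω) {s : ℝ} (hs : 0 < s)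
    {x : EuclideanSpace ℝ (Fin N)} (hx : x ∈ Ω) :
    fderiv ℝ (fun y => max (-s) (min s (u y))) x = if |u x| < s then fderiv ℝ u x else 0 := by
  have hc : ContinuousAt u x := hu.continuousAt (hΩ.mem_nhds hx)
  split_ifs with h
  · apply EventuallyEq.fderiv_eq
    filter_upwards [hc.abs.eventually_lt_const h] with y hy
    rw [abs_lt] at hy
    rw [min_eq_right hy.2.le, max_eq_right hy.1.le]
  · rw [not_lt, le_abs'] at h
    rcases h with h | h
    · apply IsLocalMin.fderiv_eq_zero
      refine Eventually.of_forall fun y => ?_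
      simp only
      rw [min_eq_right (by linarith), max_eq_left h]
      exact le_max_left _ _
    · apply IsLocalMax.fderiv_eq_zero
      refine Eventually.of_forall fun y => ?_
      have hs' : -s ≤ s := by linarith
      simp only
      rw [min_eq_left h, max_eq_right hs']
      exact max_le hs' (min_le_left _ _)

theorem abs_rpow_sub_two_mul_sub_max_min {p : ℝ} (hp : 1 < p) (x : ℝ) {s : ℝ} (hs : 0 < s) :
    |x| ^ (p - 2) * x * (x - max (-s) (min s x)) = |x| ^ (p - 1) * max (|x| - s) 0 := by
  rw [← abs_rpow_sub_two_mul_self hp, abs_mul, abs_of_nonneg (Real.rpow_nonneg (abs_nonneg x) _),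
    mul_assoc, mul_assoc]
  congr 1
  rcases le_total 0 x with h | h
  · rw [abs_of_nonneg h, max_eq_right (le_min (by linarith) (by linarith))]
    congr 1
    rcases le_total s x with h' | h'
    · rw [min_eq_left h', max_eq_left (by linarith)]
    · rw [min_eq_right h', max_eq_right (by linarith), sub_self]
  · rw [abs_of_nonpos h, min_eq_right (by linarith)]
    rcases le_total (-s) x with h' | h'
    · rw [max_eq_right h', max_eq_right (by linarith)]; ring
    · rw [max_eq_left h', max_eq_left (by linarith)]; ring

theorem integrableOn_weight_mul_superlevel {N : ℕ} {p : ℝ}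
    {Ω : Set (EuclideanSpace ℝ (Fin N))} (hΩ : IsOpen Ω)
    {φ : EuclideanSpace ℝ (Fin N) → ℝ} (hφ : ∀ x ∈ Ω, 0 ≤ φ x) (hφL : IntegrableOn φ Ω)
    {u : EuclideanSpace ℝ (Fin N) → ℝ} (huc : ContinuousOn u Ω)
    (hE : IntegrableOn (fun x => φ x * ‖fderiv ℝ u x‖ ^ p) Ω) (s : ℝ) :
    IntegrableOn (fun x => φ x * (if |u x| < s then 0 else ‖fderiv ℝ u x‖ ^ p)) Ω := by
  have hΩm := hΩ.measurableSet
  have hm : Measurable fun x => ‖fderiv ℝ u x‖ ^ p := (measurable_fderiv ℝ u).norm.pow_const p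
  have hset : MeasurableSet (Ω ∩ {x | |u x| < s}) :=
    (huc.abs.isOpen_inter_preimage hΩ isOpen_Iio).measurableSet
  refine hE.mono' ?_ ?_
  · refine hφL.aestronglyMeasurable.mul ?_
    classical
    refine AEStronglyMeasurable.congr (f := (Ω ∩ {x | |u x| < s}).piecewise (fun _ => (0 : ℝ))
      fun x => ‖fderiv ℝ u x‖ ^ p)
      (Measurable.piecewise hset measurable_const hm).aestronglyMeasurable ?_
    filter_upwards [ae_restrict_mem hΩm] with x hx
    simp [piecewise, hx]
  · filter_upwards [ae_restrict_mem hΩm] with x hx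
    have h1 := Real.rpow_nonneg (norm_nonneg (fderiv ℝ u x)) p
    have h2 := hφ x hx
    split_ifs
    · simpa using mul_nonneg h2 h1
    · rw [Real.norm_eq_abs, abs_of_nonneg (mul_nonneg h2 h1)]

/-- Energy estimate on the superlevel sets of a first eigenfunction. -/
theorem setIntegral_superlevel_le {N k : ℕ} {p : ℝ} (hp : 1 < p)
    {Ω : Set (EuclideanSpace ℝ (Fin N))} (hΩ : IsOpen Ω) (hconv : Convex ℝ Ω)
    (hbdd : Bornology.IsBounded Ω) (hne : Ω.Nonempty)
    {φ : EuclideanSpace ℝ (Fin N) → ℝ} (hφ : ∀ x ∈ Ω, 0 ≤ φ x) (hφc : ContinuousOn φ Ω)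
    (hφL : IntegrableOn φ Ω) (hcon : HasContraction Ω (weightedMeasure Ω φ) k)
    {u : EuclideanSpace ℝ (Fin N) → ℝ} (hu : IsFirstEigenfunction p Ω φ u) {s : ℝ} (hs : 0 < s) :
    ∫ x in Ω, φ x * (if |u x| < s then 0 else ‖fderiv ℝ u x‖ ^ p) ≤
      p * muP p Ω φ * ∫ x in Ω, φ x * (|u x| ^ (p - 1) * max (|u x| - s) 0) := by
  obtain ⟨hL, -, hup, hE, hu0, heq⟩ := hu
  have hL : LocallyLipschitzOn Ω u := hL
  have hp0 : 0 < p := by linarith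
  have hΩm := hΩ.measurableSet
  have huc := hL.continuousOn
  have hwL : LocallyLipschitzOn Ω fun y => max (-s) (min s (u y)) := by
    intro x hx
    obtain ⟨K, t, ht, hK⟩ := hL hx
    refine ⟨K, t, ht, ?_⟩
    have : LipschitzWith 1 fun y : ℝ => max (-s) (min s y) :=
      (LipschitzWith.id.const_min s).const_max (-s)
    simpa [Function.comp_def] using this.comp_lipschitzOnWith hK
  have hM : ∀ x ∈ Ω, |max (-s) (min s (u x))| ≤ s := fun x _ => by
    rw [abs_le]
    exact ⟨le_max_left _ _, max_le (by linarith) (min_le_left _ _)⟩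
  have hfd : EqOn (fun x => φ x * ‖fderiv ℝ (fun y => max (-s) (min s (u y))) x‖ ^ p)
      (fun x => φ x * ‖fderiv ℝ u x‖ ^ p -
        φ x * (if |u x| < s then 0 else ‖fderiv ℝ u x‖ ^ p)) Ω := by
    intro x hx
    simp only [fderiv_max_min hΩ huc hs hx]
    split_ifs <;> simp [Real.zero_rpow hp0.ne']
  have hE' := integrableOn_weight_mul_superlevel hΩ hφ hφL huc hE s
  have hwE : IntegrableOn
      (fun x => φ x * ‖fderiv ℝ (fun y => max (-s) (min s (u y))) x‖ ^ p) Ω :=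
    (hE.sub hE').congr_fun hfd.symm hΩm
  have h := muP_mul_sub_le hp hΩ hconv hbdd hne hφ hφc hφL hcon huc hup hu0 hwL hM hwE
  have hcongr : ∫ x in Ω, φ x * (|u x| ^ (p - 2) * u x) * (u x - max (-s) (min s (u x))) =
      ∫ x in Ω, φ x * (|u x| ^ (p - 1) * max (|u x| - s) 0) :=
    setIntegral_congr_fun hΩm fun x _ => by
      simp only [← abs_rpow_sub_two_mul_sub_max_min hp _ hs, mul_assoc]
  rw [setIntegral_congr_fun hΩm hfd, integral_sub hE hE', heq, hcongr] at h
  linarith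

/-- The cone of height `r` over the ball of radius `r` centred at `x`. -/
noncomputable def coneFun {N : ℕ} (x : EuclideanSpace ℝ (Fin N)) (r : ℝ)
    (y : EuclideanSpace ℝ (Fin N)) : ℝ :=
  max (r - dist y x) 0

section coneFun

variable {N : ℕ} (x : EuclideanSpace ℝ (Fin N)) (r : ℝ)

theorem coneFun_nonneg (y : EuclideanSpace ℝ (Fin N)) : 0 ≤ coneFun x r y := le_max_right _ _

theorem coneFun_le {r : ℝ} (hr : 0 ≤ r) (y : EuclideanSpace ℝ (Fin N)) : coneFun x r y ≤ r :=
  max_le (by linarith [dist_nonneg (x := y) (y := x)]) hr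

theorem coneFun_eq_zero_iff (y : EuclideanSpace ℝ (Fin N)) :
    coneFun x r y = 0 ↔ y ∉ Metric.ball x r := by
  rw [coneFun, max_eq_right_iff, Metric.mem_ball, not_lt, sub_nonpos]

theorem lipschitzWith_coneFun : LipschitzWith 1 (coneFun x r) := by
  have h : LipschitzWith 1 fun y : EuclideanSpace ℝ (Fin N) => r - dist y x := by
    refine LipschitzWith.of_dist_le_mul fun y z => ?_
    rw [Real.dist_eq, NNReal.coe_one, one_mul, abs_sub_comm, sub_sub_sub_cancel_left]
    exact abs_dist_sub_le y z x
  exact h.max_const 0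

theorem norm_fderiv_coneFun_le (y : EuclideanSpace ℝ (Fin N)) :
    ‖fderiv ℝ (coneFun x r) y‖ ≤ (Metric.ball x r).indicator (fun _ => (1 : ℝ)) y := by
  by_cases hy : y ∈ Metric.ball x r
  · rw [indicator_of_mem hy]
    simpa using norm_fderiv_le_of_lipschitz ℝ (lipschitzWith_coneFun x r)
  · rw [indicator_of_notMem hy, IsLocalMin.fderiv_eq_zero, norm_zero]
    refine Eventually.of_forall fun z => ?_
    rw [(coneFun_eq_zero_iff x r y).2 hy]
    exact coneFun_nonneg x r z

end coneFun

theorem integrableOn_weight_mul_coneFun {N : ℕ} {Ω : Set (EuclideanSpace ℝ (Fin N))}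
    {φ : EuclideanSpace ℝ (Fin N) → ℝ} (hφL : IntegrableOn φ Ω)
    (x : EuclideanSpace ℝ (Fin N)) {r q : ℝ} (hr : 0 ≤ r) (hq : 0 < q) :
    IntegrableOn (fun y => φ y * coneFun x r y ^ q) Ω := by
  refine hφL.mul_bdd (c := r ^ q) ?_ (Eventually.of_forall fun y => ?_)
  · exact ((lipschitzWith_coneFun x r).continuous.rpow_const
      fun _ => Or.inr hq.le).aestronglyMeasurable
  · have := coneFun_nonneg x r y
    rw [Real.norm_eq_abs, abs_of_nonneg (by positivity)]
    exact Real.rpow_le_rpow this (coneFun_le x hr y) hq.le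

theorem setIntegral_weight_mul_coneFun_pos {N : ℕ} {Ω : Set (EuclideanSpace ℝ (Fin N))}
    (hΩ : IsOpen Ω) {φ : EuclideanSpace ℝ (Fin N) → ℝ} (hφ : ∀ x ∈ Ω, 0 < φ x)
    (hφL : IntegrableOn φ Ω) {x : EuclideanSpace ℝ (Fin N)} (hx : x ∈ Ω) {r q : ℝ} (hr : 0 < r)
    (hq : 0 < q) : 0 < ∫ y in Ω, φ y * coneFun x r y ^ q := by
  rw [setIntegral_pos_iff_support_of_nonneg_ae]
  · have hopen : IsOpen (Ω ∩ Metric.ball x r) := hΩ.inter Metric.isOpen_ball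
    refine (hopen.measure_pos volume ⟨x, hx, Metric.mem_ball_self hr⟩).trans_le
      (measure_mono fun y hy => ⟨?_, hy.1⟩)
    have h1 : coneFun x r y ≠ 0 := fun h => (coneFun_eq_zero_iff x r y).1 h hy.2
    have h2 : 0 < coneFun x r y := (coneFun_nonneg x r y).lt_of_ne h1.symm
    exact (mul_pos (hφ y hy.1) (Real.rpow_pos_of_pos h2 q)).ne'
  · filter_upwards [ae_restrict_mem hΩ.measurableSet] with y hy
    exact mul_nonneg (hφ y hy).le (Real.rpow_nonneg (coneFun_nonneg x r y) q)
  · exact integrableOn_weight_mul_coneFun hφL x hr.le hq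

theorem integrableOn_weight_mul_indicator {N : ℕ} {Ω : Set (EuclideanSpace ℝ (Fin N))}
    {φ : EuclideanSpace ℝ (Fin N) → ℝ} (hφL : IntegrableOn φ Ω)
    {A : Set (EuclideanSpace ℝ (Fin N))} (hA : MeasurableSet A) :
    IntegrableOn (fun y => φ y * A.indicator (fun _ => (1 : ℝ)) y) Ω := by
  refine hφL.mul_bdd (c := 1) ?_ (Eventually.of_forall fun y => ?_)
  · exact (measurable_const.indicator hA).aestronglyMeasurable
  · by_cases hy : y ∈ A <;> simp [hy]

theorem setIntegral_ball_le_coneFun {N k : ℕ} {Ω : Set (EuclideanSpace ℝ (Fin N))}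
    (hΩ : IsOpen Ω) {φ : EuclideanSpace ℝ (Fin N) → ℝ} (hφ : ∀ x ∈ Ω, 0 < φ x)
    (hφc : ContinuousOn φ Ω) (hφL : IntegrableOn φ Ω)
    (hcon : HasContraction Ω (weightedMeasure Ω φ) k)
    {x : EuclideanSpace ℝ (Fin N)} (hx : x ∈ Ω) {r p : ℝ} (hr : 0 < r) (hp : 0 < p) :
    ∫ y in Ω, φ y * (Metric.ball x r).indicator (fun _ => (1 : ℝ)) y ≤
      2 ^ k * (2 / r) ^ p * ∫ y in Ω, φ y * coneFun x r y ^ p := by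
  have hφ' : ∀ x ∈ Ω, 0 ≤ φ x := fun x hx => (hφ x hx).le
  have hI := setIntegral_weight_mul_coneFun_pos hΩ hφ hφL hx hr hp
  refine setIntegral_weight_mul_le hΩ hφ' hφc
    (fun y _ => indicator_nonneg (fun _ _ => zero_le_one) y) (by positivity) ?_
  have hcm : Measurable fun z => ENNReal.ofReal (coneFun x r z ^ p) :=
    ((lipschitzWith_coneFun x r).continuous.measurable.pow_const p).ennreal_ofReal
  have h := hcon x hx (1 / 2) (by norm_num) (by norm_num)
    (fun z => ENNReal.ofReal ((2 / r) ^ p) * ENNReal.ofReal (coneFun x r z ^ p))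
    (hcm.const_mul _)
  rw [ENNReal.ofReal_mul (by positivity), ENNReal.ofReal_mul (by positivity),
    ← lintegral_ofReal_weightedMeasure hΩ hφ' hφc
      (fun y _ => Real.rpow_nonneg (coneFun_nonneg x r y) p)
      (integrableOn_weight_mul_coneFun hφL x hr.le hp), mul_assoc]
  rw [lintegral_const_mul _ hcm] at h
  have h2 : (((1 : ℝ) / 2) ^ k)⁻¹ = 2 ^ k := by rw [one_div, inv_pow, inv_inv]
  rw [h2] at h
  refine le_trans (lintegral_mono fun y => ?_) h
  by_cases hy : y ∈ Metric.ball x r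
  · rw [indicator_of_mem hy, ← ENNReal.ofReal_mul (by positivity)]
    apply ENNReal.ofReal_le_ofReal
    have hd : dist ((1 - (1 : ℝ) / 2) • x + ((1 : ℝ) / 2) • y) x = dist y x / 2 := by
      have : (1 - (1 : ℝ) / 2) • x + ((1 : ℝ) / 2) • y - x = ((1 : ℝ) / 2) • (y - x) := by
        module
      rw [dist_eq_norm, this, norm_smul, dist_eq_norm]
      norm_num
      ring
    rw [← Real.mul_rpow (by positivity) (coneFun_nonneg _ _ _)]
    apply Real.one_le_rpow _ hp.le
    rw [div_mul_eq_mul_div, one_le_div hr]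
    have := le_max_left (r - dist ((1 - (1 : ℝ) / 2) • x + ((1 : ℝ) / 2) • y) x) 0
    rw [hd] at this
    rw [coneFun, hd]
    rw [Metric.mem_ball] at hy
    linarith
  · rw [indicator_of_notMem hy]
    simp

theorem abs_sub_rpow_of_mul_eq_zero {p a b c : ℝ} (hp : 0 < p) (ha : 0 ≤ a) (hb : 0 ≤ b)
    (hc : 0 ≤ c) (hab : a = 0 ∨ b = 0) : |a - c * b| ^ p = a ^ p + c ^ p * b ^ p := by
  rcases hab with rfl | rfl
  · rw [zero_sub, abs_neg, abs_of_nonneg (by positivity), Real.mul_rpow hc hb,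
      Real.zero_rpow hp.ne', zero_add]
  · rw [mul_zero, sub_zero, abs_of_nonneg ha, Real.zero_rpow hp.ne', mul_zero, add_zero]

theorem abs_sub_rpow_mul_of_mul_eq_zero {p a b c : ℝ} (hp : 1 < p) (ha : 0 ≤ a) (hb : 0 ≤ b)
    (hc : 0 ≤ c) (hab : a = 0 ∨ b = 0) :
    |a - c * b| ^ (p - 2) * (a - c * b) = a ^ (p - 1) - c ^ (p - 1) * b ^ (p - 1) := by
  have hp1 : p - 1 ≠ 0 := by linarith
  have key : ∀ x : ℝ, 0 ≤ x → |x| ^ (p - 2) * x = x ^ (p - 1) := fun x hx => by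
    have h := abs_rpow_sub_two_mul_self hp x
    rw [abs_of_nonneg (mul_nonneg (Real.rpow_nonneg (abs_nonneg _) _) hx)] at h
    rw [h, abs_of_nonneg hx]
  rcases hab with rfl | rfl
  · rw [zero_sub, abs_neg, mul_neg, key _ (by positivity), Real.mul_rpow hc hb,
      Real.zero_rpow hp1, zero_sub]
  · rw [mul_zero, sub_zero, key _ ha, Real.zero_rpow hp1, mul_zero, sub_zero]

/-- Upper bound for the first eigenvalue in terms of the diameter. -/
theorem muP_le_of_ne {N k : ℕ} {p : ℝ} (hp : 1 < p) {Ω : Set (EuclideanSpace ℝ (Fin N))}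
    (hΩ : IsOpen Ω) {φ : EuclideanSpace ℝ (Fin N) → ℝ} (hφ : ∀ x ∈ Ω, 0 < φ x)
    (hφc : ContinuousOn φ Ω) (hφL : IntegrableOn φ Ω)
    (hcon : HasContraction Ω (weightedMeasure Ω φ) k)
    {x y : EuclideanSpace ℝ (Fin N)} (hx : x ∈ Ω) (hy : y ∈ Ω) (hxy : x ≠ y) :
    muP p Ω φ ≤ 2 ^ k * (4 / dist x y) ^ p := by
  have hp0 : 0 < p := by linarith
  have hp1 : 0 < p - 1 := by linarith
  have hφ' : ∀ x ∈ Ω, 0 ≤ φ x := fun x hx => (hφ x hx).le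
  have hΩm := hΩ.measurableSet
  set r := dist x y / 2 with hr
  have hr0 : 0 < r := half_pos (dist_pos.2 hxy)
  have hI := setIntegral_weight_mul_coneFun_pos hΩ hφ hφL hx hr0 hp0
  have hJ := setIntegral_weight_mul_coneFun_pos hΩ hφ hφL hy hr0 hp0
  have hI' := setIntegral_weight_mul_coneFun_pos hΩ hφ hφL hx hr0 hp1
  have hJ' := setIntegral_weight_mul_coneFun_pos hΩ hφ hφL hy hr0 hp1
  have hB1 := setIntegral_ball_le_coneFun hΩ hφ hφc hφL hcon hx hr0 hp0
  have hB2 := setIntegral_ball_le_coneFun hΩ hφ hφc hφL hcon hy hr0 hp0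
  have hIi := integrableOn_weight_mul_coneFun hφL x hr0.le hp0
  have hJi := integrableOn_weight_mul_coneFun hφL y hr0.le hp0
  have hIi' := integrableOn_weight_mul_coneFun hφL x hr0.le hp1
  have hJi' := integrableOn_weight_mul_coneFun hφL y hr0.le hp1
  have hb1 := integrableOn_weight_mul_indicator hφL
    (Metric.isOpen_ball (x := x) (ε := r)).measurableSet
  have hb2 := integrableOn_weight_mul_indicator hφL
    (Metric.isOpen_ball (x := y) (ε := r)).measurableSet
  set I := ∫ z in Ω, φ z * coneFun x r z ^ p
  set J := ∫ z in Ω, φ z * coneFun y r z ^ p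
  set I' := ∫ z in Ω, φ z * coneFun x r z ^ (p - 1)
  set J' := ∫ z in Ω, φ z * coneFun y r z ^ (p - 1)
  set c : ℝ := (I' / J') ^ (p - 1)⁻¹ with hcdef
  have hc : 0 < c := Real.rpow_pos_of_pos (div_pos hI' hJ') _
  have hcp : c ^ (p - 1) = I' / J' := by
    rw [hcdef, Real.rpow_inv_rpow (div_pos hI' hJ').le hp1.ne']
  have hdisj : ∀ z, coneFun x r z = 0 ∨ coneFun y r z = 0 := fun z => by
    rw [coneFun_eq_zero_iff, coneFun_eq_zero_iff, Metric.mem_ball, Metric.mem_ball]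
    by_contra! h
    have := dist_triangle_left x y z
    linarith [h.1, h.2]
  set w : EuclideanSpace ℝ (Fin N) → ℝ := fun z => coneFun x r z - c * coneFun y r z with hw
  have hcL : LipschitzWith ‖c‖₊ fun z => c * coneFun y r z := by
    have := (lipschitzWith_smul c).comp (lipschitzWith_coneFun y r)
    simpa [Function.comp_def] using this
  have hwL : LipschitzWith (1 + ‖c‖₊) w := (lipschitzWith_coneFun x r).sub hcL
  have hw0 : ∫ z in Ω, φ z * |w z| ^ (p - 2) * w z = 0 := by
    have h1 : ∫ z in Ω, φ z * |w z| ^ (p - 2) * w z =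
        ∫ z in Ω, (φ z * coneFun x r z ^ (p - 1) -
          c ^ (p - 1) * (φ z * coneFun y r z ^ (p - 1))) := by
      congr 1 with z
      rw [mul_assoc, hw]
      simp only
      rw [abs_sub_rpow_mul_of_mul_eq_zero hp (coneFun_nonneg _ _ _) (coneFun_nonneg _ _ _) hc.le
        (hdisj z)]
      ring
    rw [h1, integral_sub hIi' (hJi'.const_mul _), integral_const_mul, hcp,
      div_mul_cancel₀ _ hJ'.ne', sub_self]
  have hwp : ∫ z in Ω, φ z * |w z| ^ p = I + c ^ p * J := by
    have h1 : ∫ z in Ω, φ z * |w z| ^ p =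
        ∫ z in Ω, (φ z * coneFun x r z ^ p + c ^ p * (φ z * coneFun y r z ^ p)) := by
      congr 1 with z
      rw [hw]
      simp only
      rw [abs_sub_rpow_of_mul_eq_zero hp0 (coneFun_nonneg _ _ _) (coneFun_nonneg _ _ _) hc.le
        (hdisj z)]
      ring
    rw [h1, integral_add hIi (hJi.const_mul _), integral_const_mul]
  have hdd : ∀ᵐ z, DifferentiableAt ℝ (coneFun x r) z ∧ DifferentiableAt ℝ (coneFun y r) z :=
    (lipschitzWith_coneFun x r).ae_differentiableAt.and
      (lipschitzWith_coneFun y r).ae_differentiableAt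
  have hE : ∫ z in Ω, φ z * ‖fderiv ℝ w z‖ ^ p ≤
      ∫ z in Ω, (φ z * (Metric.ball x r).indicator (fun _ => (1 : ℝ)) z +
        c ^ p * (φ z * (Metric.ball y r).indicator (fun _ => (1 : ℝ)) z)) := by
    refine integral_mono_of_nonneg ?_ (hb1.add (hb2.const_mul _)) ?_
    · filter_upwards [ae_restrict_mem hΩm] with z hz
      exact mul_nonneg (hφ' z hz) (Real.rpow_nonneg (norm_nonneg _) _)
    · filter_upwards [ae_restrict_mem hΩm, ae_restrict_of_ae hdd] with z hz hd
      have hfd : fderiv ℝ w z = fderiv ℝ (coneFun x r) z - c • fderiv ℝ (coneFun y r) z := by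
        rw [hw, fderiv_fun_sub hd.1 (hd.2.const_mul c), fderiv_const_mul hd.2]
      have h1 := norm_fderiv_coneFun_le x r z
      have h2 := norm_fderiv_coneFun_le y r z
      have key : ‖fderiv ℝ w z‖ ^ p ≤ (Metric.ball x r).indicator (fun _ => (1 : ℝ)) z +
          c ^ p * (Metric.ball y r).indicator (fun _ => (1 : ℝ)) z := by
        by_cases hzx : z ∈ Metric.ball x r
        · have hzy : z ∉ Metric.ball y r := by
            rcases hdisj z with h | h
            · exact absurd hzx ((coneFun_eq_zero_iff x r z).1 h)
            · exact (coneFun_eq_zero_iff y r z).1 h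
          rw [indicator_of_mem hzx] at h1 ⊢
          rw [indicator_of_notMem hzy] at h2 ⊢
          rw [hfd, norm_le_zero_iff.1 h2, smul_zero, sub_zero, mul_zero, add_zero]
          exact Real.rpow_le_one (norm_nonneg _) h1 hp0.le
        · rw [indicator_of_notMem hzx] at h1 ⊢
          rw [hfd, norm_le_zero_iff.1 h1, zero_sub, norm_neg, norm_smul, Real.norm_eq_abs,
            abs_of_pos hc, zero_add, Real.mul_rpow hc.le (norm_nonneg _)]
          gcongr
          by_cases hzy : z ∈ Metric.ball y r
          · rw [indicator_of_mem hzy] at h2 ⊢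
            exact Real.rpow_le_one (norm_nonneg _) h2 hp0.le
          · rw [indicator_of_notMem hzy] at h2 ⊢
            rw [norm_le_zero_iff.1 h2, norm_zero, Real.zero_rpow hp0.ne']
      have := mul_le_mul_of_nonneg_left key (hφ' z hz)
      linarith
  rw [integral_add hb1 (hb2.const_mul _), integral_const_mul] at hE
  have hmain := muP_mul_le hp hΩm hφ' hwL hw0
  rw [hwp] at hmain
  have hcp0 : 0 < c ^ p := Real.rpow_pos_of_pos hc p
  have hpos : 0 < I + c ^ p * J := by positivity
  have h2r : 2 / r = 4 / dist x y := by
    rw [hr, div_div_eq_mul_div]; norm_num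
  rw [← h2r]
  refine le_of_mul_le_mul_right (hmain.trans (hE.trans ?_)) hpos
  have := mul_le_mul_of_nonneg_left hB2 hcp0.le
  linarith

/-- The diameter in terms of the first eigenvalue. -/
theorem exists_dist_le_and_muP_mul_le {N k : ℕ} {p : ℝ} (hp : 1 < p)
    {Ω : Set (EuclideanSpace ℝ (Fin N))}
    (hΩ : IsOpen Ω) (hbdd : Bornology.IsBounded Ω)
    {φ : EuclideanSpace ℝ (Fin N) → ℝ} (hφ : ∀ x ∈ Ω, 0 < φ x)
    (hφc : ContinuousOn φ Ω) (hφL : IntegrableOn φ Ω)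
    (hcon : HasContraction Ω (weightedMeasure Ω φ) k) :
    ∃ d : ℝ, 0 ≤ d ∧ (∀ x ∈ Ω, ∀ y ∈ Ω, ‖x - y‖ ≤ d) ∧ muP p Ω φ * d ^ p ≤ 2 ^ k * 4 ^ p := by
  have hp0 : 0 < p := by linarith
  have hμ := muP_nonneg p hΩ.measurableSet fun x hx => (hφ x hx).le
  rcases hμ.eq_or_lt with h0 | h0
  · refine ⟨Metric.diam Ω, Metric.diam_nonneg, fun x hx y hy => ?_, ?_⟩
    · rw [← dist_eq_norm]
      exact Metric.dist_le_diam_of_mem hbdd hx hy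
    · rw [← h0, zero_mul]
      positivity
  · have hq : 0 ≤ 2 ^ k * 4 ^ p / muP p Ω φ := by positivity
    refine ⟨(2 ^ k * 4 ^ p / muP p Ω φ) ^ p⁻¹, by positivity, fun x hx y hy => ?_, ?_⟩
    · rcases eq_or_ne x y with rfl | hxy
      · rw [sub_self, norm_zero]
        positivity
      · have h := muP_le_of_ne hp hΩ hφ hφc hφL hcon hx hy hxy
        have hd := dist_pos.2 hxy
        rw [← dist_eq_norm, Real.le_rpow_inv_iff_of_pos hd.le hq hp0, le_div_iff₀ h0]
        rw [Real.div_rpow (by norm_num) hd.le, mul_div_assoc', le_div_iff₀ (by positivity)] at h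
        linarith
    · rw [Real.rpow_inv_rpow hq hp0.ne', mul_div_cancel₀ _ h0.ne']

theorem LocallyLipschitzOn.max_abs_sub {N : ℕ} {Ω : Set (EuclideanSpace ℝ (Fin N))}
    {u : EuclideanSpace ℝ (Fin N) → ℝ} (hu : LocallyLipschitzOn Ω u) (s : ℝ) :
    LocallyLipschitzOn Ω fun x => max (|u x| - s) 0 := by
  intro x hx
  obtain ⟨K, t, ht, hK⟩ := hu hx
  refine ⟨K, t, ht, ?_⟩
  have h1 : LipschitzWith 1 fun y : ℝ => |y| - s := by
    refine LipschitzWith.of_dist_le_mul fun y z => ?_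
    rw [Real.dist_eq, Real.dist_eq, NNReal.coe_one, one_mul, sub_sub_sub_cancel_right]
    exact abs_abs_sub_abs_le_abs_sub y z
  have h2 : LipschitzWith 1 fun y : ℝ => max (|y| - s) 0 := h1.max_const 0
  simpa [Function.comp_def] using h2.comp_lipschitzOnWith hK

theorem norm_fderiv_max_abs_sub_le {N : ℕ} {Ω : Set (EuclideanSpace ℝ (Fin N))} (hΩ : IsOpen Ω)
    {u : EuclideanSpace ℝ (Fin N) → ℝ} (hu : ContinuousOn u Ω) {s : ℝ} (hs : 0 ≤ s)
    {x : EuclideanSpace ℝ (Fin N)} (hx : x ∈ Ω) :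
    ‖fderiv ℝ (fun y => max (|u y| - s) 0) x‖ ≤ if |u x| < s then 0 else ‖fderiv ℝ u x‖ := by
  have hc : ContinuousAt u x := hu.continuousAt (hΩ.mem_nhds hx)
  have hmin : |u x| ≤ s → fderiv ℝ (fun y => max (|u y| - s) 0) x = 0 := fun h => by
    apply IsLocalMin.fderiv_eq_zero
    refine Eventually.of_forall fun y => ?_
    simp only
    rw [max_eq_right (by linarith : |u x| - s ≤ 0)]
    exact le_max_right _ _
  split_ifs with h
  · rw [hmin h.le, norm_zero]
  rcases (not_lt.1 h).eq_or_lt with h' | h'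
  · rw [hmin h'.ge, norm_zero]
    exact norm_nonneg _
  rcases lt_abs.1 h' with h'' | h''
  · have : (fun y => max (|u y| - s) 0) =ᶠ[𝓝 x] fun y => u y - s := by
      filter_upwards [hc.eventually_const_lt h''] with y hy
      rw [abs_of_nonneg (by linarith), max_eq_left (by linarith)]
    rw [this.fderiv_eq, fderiv_sub_const]
  · have : (fun y => max (|u y| - s) 0) =ᶠ[𝓝 x] fun y => -u y - s := by
      filter_upwards [hc.neg.eventually_const_lt h''] with y hy
      rw [Pi.neg_apply] at hy
      rw [abs_of_nonpos (by linarith), max_eq_left (by linarith)]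
    rw [this.fderiv_eq, fderiv_sub_const, fderiv_fun_neg, norm_neg]

theorem integrableOn_weight_mul_max_rpow {N : ℕ} {p : ℝ} (hp : 0 < p)
    {Ω : Set (EuclideanSpace ℝ (Fin N))} (hΩ : MeasurableSet Ω)
    {φ : EuclideanSpace ℝ (Fin N) → ℝ} (hφ : ∀ x ∈ Ω, 0 ≤ φ x) (hφL : IntegrableOn φ Ω)
    {u : EuclideanSpace ℝ (Fin N) → ℝ} (hu : ContinuousOn u Ω)
    (hup : IntegrableOn (fun x => φ x * |u x| ^ p) Ω) {s : ℝ} (hs : 0 ≤ s) :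
    IntegrableOn (fun x => φ x * max (|u x| - s) 0 ^ p) Ω := by
  refine hup.mono' (hφL.aestronglyMeasurable.mul ?_) ?_
  · exact (((hu.abs.sub continuousOn_const).sup continuousOn_const).rpow_const
      fun _ _ => Or.inr hp.le).aestronglyMeasurable hΩ
  · filter_upwards [ae_restrict_mem hΩ] with x hx
    have h := hφ x hx
    have h0 : 0 ≤ max (|u x| - s) 0 := le_max_right _ _
    rw [Real.norm_eq_abs, abs_of_nonneg (by positivity)]
    gcongr
    exact max_le (by linarith) (abs_nonneg _)

theorem weightedMeasure_univ {N : ℕ} {Ω : Set (EuclideanSpace ℝ (Fin N))}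
    (hΩ : IsOpen Ω) {φ : EuclideanSpace ℝ (Fin N) → ℝ} (hφ : ∀ x ∈ Ω, 0 ≤ φ x)
    (hφc : ContinuousOn φ Ω) (hφL : IntegrableOn φ Ω) :
    weightedMeasure Ω φ univ = ENNReal.ofReal (∫ x in Ω, φ x) := by
  have h := lintegral_ofReal_weightedMeasure hΩ hφ hφc (g := fun _ => 1)
    (fun _ _ => zero_le_one) (by simpa using hφL)
  simpa using h

theorem abs_rpow_sub_one_mul_max_le {p : ℝ} (hp : 1 < p) {a s s' : ℝ} (hs' : 0 ≤ s')
    (hs : s' < s) :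
    |a| ^ (p - 1) * max (|a| - s) 0 ≤ (s / (s - s')) ^ p * max (|a| - s') 0 ^ p := by
  have hd : 0 < s - s' := by linarith
  have hL : 0 ≤ s / (s - s') := div_nonneg (by linarith) hd.le
  have h0 : 0 ≤ max (|a| - s') 0 := le_max_right _ _
  rcases le_total |a| s with h | h
  · rw [max_eq_right (by linarith), mul_zero]
    positivity
  · rw [← Real.mul_rpow hL h0, max_eq_left (by linarith : 0 ≤ |a| - s),
      max_eq_left (by linarith : 0 ≤ |a| - s')]
    calc |a| ^ (p - 1) * (|a| - s) ≤ |a| ^ (p - 1) * |a| := by gcongr; linarith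
      _ = |a| ^ p := abs_rpow_sub_one_mul_abs hp a
      _ ≤ _ := by
        gcongr
        rw [div_mul_eq_mul_div, le_div_iff₀ hd]
        nlinarith

/-- One step of the De Giorgi iteration. -/
theorem setIntegral_max_rpow_step {N k : ℕ} (hk : 2 ≤ k) {p : ℝ} (hp : 1 < p)
    {Ω : Set (EuclideanSpace ℝ (Fin N))} (hΩ : IsOpen Ω) (hconv : Convex ℝ Ω)
    (hbdd : Bornology.IsBounded Ω) (hne : Ω.Nonempty)
    {φ : EuclideanSpace ℝ (Fin N) → ℝ} (hφ : ∀ x ∈ Ω, 0 < φ x) (hφc : ContinuousOn φ Ω)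
    (hφL : IntegrableOn φ Ω) (hcon : HasContraction Ω (weightedMeasure Ω φ) k)
    {u : EuclideanSpace ℝ (Fin N) → ℝ} (hu : IsFirstEigenfunction p Ω φ u)
    {s s' τ : ℝ} (hs' : 0 ≤ s') (hs : s' < s) (hτ : 0 < τ) (hτ2 : τ ≤ 1 / 2)
    (h : ∫ x in Ω, φ x * max (|u x| - s') 0 ^ p ≤ (s - s') ^ p * (τ ^ k * ∫ x in Ω, φ x)) :
    ∫ x in Ω, φ x * max (|u x| - s) 0 ^ p ≤
      4 / 3 * 2 ^ k * p * (2 ^ k * 4 ^ p) * τ * (s / (s - s')) ^ p *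
        ∫ x in Ω, φ x * max (|u x| - s') 0 ^ p := by
  have hp0 : 0 < p := by linarith
  have hφ' : ∀ x ∈ Ω, 0 ≤ φ x := fun x hx => (hφ x hx).le
  have hΩm := hΩ.measurableSet
  have hs0 : 0 < s := by linarith
  have hd : 0 < s - s' := by linarith
  obtain ⟨d, hd0, hdist, hμd⟩ := exists_dist_le_and_muP_mul_le hp hΩ hbdd hφ hφc hφL hcon
  have hEI := setIntegral_superlevel_le hp hΩ hconv hbdd hne hφ' hφc hφL hcon hu hs0
  obtain ⟨hL, -, hup, hE, -, -⟩ := hu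
  have hL : LocallyLipschitzOn Ω u := hL
  have huc := hL.continuousOn
  have hnn : ∀ (t : ℝ) (x : EuclideanSpace ℝ (Fin N)), 0 ≤ max (|u x| - t) 0 ^ p := fun t x =>
    Real.rpow_nonneg (le_max_right _ _) _
  have hYs := integrableOn_weight_mul_max_rpow hp0 hΩm hφ' hφL huc hup hs0.le
  have hYs' := integrableOn_weight_mul_max_rpow hp0 hΩm hφ' hφL huc hup hs'
  have hEs := integrableOn_weight_mul_superlevel hΩ hφ' hφL huc hE s
  set ν := weightedMeasure Ω φ with hν
  have hνu : ν univ = ENNReal.ofReal (∫ x in Ω, φ x) := weightedMeasure_univ hΩ hφ' hφc hφL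
  have : IsFiniteMeasure ν := ⟨by rw [hνu]; exact ENNReal.ofReal_lt_top⟩
  have hνΩ : ν Ωᶜ = 0 := by
    rw [← lintegral_indicator_one hΩm.compl, hν, lintegral_weightedMeasure hΩ hφc,
      setLIntegral_congr_fun (g := fun _ => 0) hΩm (fun x hx => by simp [hx]), lintegral_zero]
  set A := Ω ∩ {x | s < |u x|} with hAdef
  have hA : MeasurableSet A := (huc.abs.isOpen_inter_preimage hΩ isOpen_Ioi).measurableSet
  have hνA : ν A ≤ ENNReal.ofReal (τ ^ k) * ν univ := by
    rw [hνu, ← ENNReal.ofReal_mul (by positivity)]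
    have hi : IntegrableOn (fun x => φ x * (((s - s') ^ p)⁻¹ * max (|u x| - s') 0 ^ p)) Ω :=
      IntegrableOn.congr_fun (hYs'.const_mul (((s - s') ^ p)⁻¹))
        (fun x _ => mul_left_comm _ _ _) hΩm
    have h1 := lintegral_ofReal_weightedMeasure hΩ hφ' hφc
      (fun x _ => mul_nonneg (by positivity) (hnn s' x)) hi
    simp only [mul_left_comm (φ _)] at h1
    rw [integral_const_mul] at h1
    refine le_trans ?_ (h1.le.trans (ENNReal.ofReal_le_ofReal ?_))
    · rw [← lintegral_indicator_one hA]
      refine lintegral_mono fun x => ?_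
      by_cases hx : x ∈ A
      · rw [indicator_of_mem hx, Pi.one_apply, ENNReal.one_le_ofReal, ← div_eq_inv_mul,
          one_le_div (by positivity)]
        have hx2 : s < |u x| := hx.2
        exact Real.rpow_le_rpow hd.le ((by linarith : s - s' ≤ |u x| - s').trans (le_max_left _ _))
          hp0.le
      · rw [indicator_of_notMem hx]
        exact zero_le
    · rw [inv_mul_le_iff₀ (by positivity)]
      exact h
  have hFK := setLIntegral_rpow_le_lintegral_gradNorm hk hΩm hconv hνΩ hcon (hL.max_abs_sub s)
    hA inter_subset_left (fun x hx => by
      have : ¬ s < |u x| := fun h => hx.2 ⟨hx.1, h⟩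
      exact max_eq_right (by linarith)) hτ hτ2 hνA hd0 hdist hp.le
  have hgrad : ∫⁻ z, gradNorm (fun x => max (|u x| - s) 0) z ^ p ∂ν ≤
      ENNReal.ofReal (∫ x in Ω, φ x * (if |u x| < s then 0 else ‖fderiv ℝ u x‖ ^ p)) := by
    rw [← lintegral_ofReal_weightedMeasure hΩ hφ' hφc (fun x _ => by
      split_ifs <;> positivity) hEs, lintegral_weightedMeasure hΩ hφc,
      lintegral_weightedMeasure hΩ hφc]
    refine lintegral_mono_ae ?_
    filter_upwards [ae_restrict_mem hΩm,
      ae_restrict_of_ae ((hL.max_abs_sub s).ae_differentiableAt hΩ)] with x hx hdiff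
    gcongr
    rw [gradNorm, if_pos (hdiff hx), ENNReal.ofReal_rpow_of_nonneg (norm_nonneg _) hp0.le]
    apply ENNReal.ofReal_le_ofReal
    have := Real.rpow_le_rpow (norm_nonneg _) (norm_fderiv_max_abs_sub_le hΩ huc hs0.le hx) hp0.le
    refine this.trans_eq ?_
    split_ifs
    · exact Real.zero_rpow hp0.ne'
    · rfl
  have hY : ENNReal.ofReal (∫ x in Ω, φ x * max (|u x| - s) 0 ^ p) ≤
      ∫⁻ x in A, ENNReal.ofReal (|max (|u x| - s) 0| ^ p) ∂ν := by
    rw [← lintegral_ofReal_weightedMeasure hΩ hφ' hφc (fun x _ => hnn s x) hYs,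
      ← lintegral_indicator hA, lintegral_weightedMeasure hΩ hφc, lintegral_weightedMeasure hΩ hφc]
    refine setLIntegral_mono' hΩm fun x hx => ?_
    gcongr
    by_cases hxs : s < |u x|
    · rw [indicator_of_mem (show x ∈ A from ⟨hx, hxs⟩), abs_of_nonneg (le_max_right (|u x| - s) 0)]
    · rw [max_eq_right (by linarith), Real.zero_rpow hp0.ne', ENNReal.ofReal_zero]
      exact zero_le
  have hG0 : 0 ≤ ∫ x in Ω, φ x * (if |u x| < s then 0 else ‖fderiv ℝ u x‖ ^ p) :=
    setIntegral_nonneg hΩm fun x hx => mul_nonneg (hφ' x hx) (by split_ifs <;> positivity)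
  have hFK' := hY.trans (hFK.trans (mul_le_mul_right hgrad _))
  rw [← ENNReal.ofReal_mul (by positivity),
    ENNReal.ofReal_le_ofReal_iff (mul_nonneg (by positivity) hG0)] at hFK'
  have hR : ∫ x in Ω, φ x * (|u x| ^ (p - 1) * max (|u x| - s) 0) ≤
      (s / (s - s')) ^ p * ∫ x in Ω, φ x * max (|u x| - s') 0 ^ p := by
    rw [← integral_const_mul]
    refine integral_mono_of_nonneg ?_ (hYs'.const_mul _) ?_
    · filter_upwards [ae_restrict_mem hΩm] with x hx
      exact mul_nonneg (hφ' x hx)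
        (mul_nonneg (Real.rpow_nonneg (abs_nonneg _) _) (le_max_right _ _))
    · filter_upwards [ae_restrict_mem hΩm] with x hx
      have := mul_le_mul_of_nonneg_left (abs_rpow_sub_one_mul_max_le hp (a := u x) hs' hs)
        (hφ' x hx)
      linarith
  have hμ := muP_nonneg p hΩm hφ'
  set Y' := ∫ x in Ω, φ x * max (|u x| - s') 0 ^ p with hY'def
  have hY'0 : 0 ≤ Y' := setIntegral_nonneg hΩm fun x hx => mul_nonneg (hφ' x hx) (hnn s' x)
  have hLp : 0 ≤ (s / (s - s')) ^ p := Real.rpow_nonneg (div_nonneg hs0.le hd.le) p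
  calc ∫ x in Ω, φ x * max (|u x| - s) 0 ^ p
      ≤ d ^ p * (4 / 3 * 2 ^ k * τ) *
          (p * muP p Ω φ * ((s / (s - s')) ^ p * Y')) := by
        refine hFK'.trans ?_
        gcongr
        refine hEI.trans ?_
        gcongr
    _ = muP p Ω φ * d ^ p * (4 / 3 * 2 ^ k * τ * p * ((s / (s - s')) ^ p * Y')) := by ring
    _ ≤ 2 ^ k * 4 ^ p * (4 / 3 * 2 ^ k * τ * p * ((s / (s - s')) ^ p * Y')) := by gcongr
    _ = _ := by ring

/-- The factor by which the measure of superlevel sets shrinks in the De Giorgi iteration. -/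
noncomputable def deGiorgiConst (p : ℝ) (k : ℕ) : ℝ :=
  4 / 3 * 2 ^ k * p * (2 ^ k * 4 ^ p) * (2 ^ p) ^ (k + 3)

/-- Sup bound for normalized first eigenfunctions. -/
theorem IsFirstEigenfunction.exists_ae_abs_le {N k : ℕ} (hk : 2 ≤ k) {p : ℝ} (hp : 1 < p)
    {Ω : Set (EuclideanSpace ℝ (Fin N))} (hΩ : IsOpen Ω) (hconv : Convex ℝ Ω)
    (hbdd : Bornology.IsBounded Ω) (hne : Ω.Nonempty)
    {φ : EuclideanSpace ℝ (Fin N) → ℝ} (hφ : ∀ x ∈ Ω, 0 < φ x) (hφc : ContinuousOn φ Ω)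
    (hφL : IntegrableOn φ Ω) (hcon : HasContraction Ω (weightedMeasure Ω φ) k)
    {u : EuclideanSpace ℝ (Fin N) → ℝ} (hu : IsFirstEigenfunction p Ω φ u)
    (hnorm : ∫ x in Ω, φ x * |u x| ^ p = 1) (hV : 0 < ∫ x in Ω, φ x) :
    ∃ M : ℝ, 0 ≤ M ∧ (∀ᵐ x ∂(volume.restrict Ω), |u x| ≤ M) ∧
      M ^ p * ∫ x in Ω, φ x = 4 ^ p * deGiorgiConst p k ^ k := by
  have hp0 : 0 < p := by linarith
  have hφ' : ∀ x ∈ Ω, 0 ≤ φ x := fun x hx => (hφ x hx).le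
  have hΩm := hΩ.measurableSet
  have hL : LocallyLipschitzOn Ω u := hu.1
  have huc := hL.continuousOn
  have hup := hu.2.2.1
  set V := ∫ x in Ω, φ x
  set Q := deGiorgiConst p k with hQ
  set b : ℝ := 2 ^ p with hb
  have hb2 : 2 ≤ b := by
    simpa using Real.rpow_le_rpow_of_exponent_le (one_le_two) hp.le
  have hb0 : 0 < b := by linarith
  have h4 : (4 : ℝ) ^ p = b ^ 2 := by
    rw [hb, ← Real.rpow_natCast, ← Real.rpow_mul (by norm_num), mul_comm,
      Real.rpow_mul (by norm_num)]
    norm_num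
  set C := 4 / 3 * 2 ^ k * p * (2 ^ k * 4 ^ p) with hC
  have hC1 : 1 ≤ C := by
    have h1 : (1 : ℝ) ≤ 2 ^ k := one_le_pow₀ one_le_two
    have h2 : (1 : ℝ) ≤ 4 ^ p := Real.one_le_rpow (by norm_num) hp0.le
    have h3 : 1 ≤ 4 / 3 * (2 : ℝ) ^ k := by linarith
    exact one_le_mul_of_one_le_of_one_le (one_le_mul_of_one_le_of_one_le h3 hp.le)
      (one_le_mul_of_one_le_of_one_le h1 h2)
  have hQC : Q = C * b ^ (k + 3) := rfl
  have hQ2 : 2 ≤ Q := by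
    rw [hQC]
    have h1 : b ≤ b ^ (k + 3) := le_self_pow₀ (by linarith) (by lia)
    nlinarith
  have hQ0 : 0 < Q := by linarith
  set S := (b * Q ^ k / V) ^ p⁻¹ with hS
  have hq : 0 < b * Q ^ k / V := by positivity
  have hS0 : 0 < S := Real.rpow_pos_of_pos hq _
  have hSp : S ^ p = b * Q ^ k / V := by rw [hS, Real.rpow_inv_rpow hq.le hp0.ne']
  set Y : ℝ → ℝ := fun s => ∫ x in Ω, φ x * max (|u x| - s) 0 ^ p with hY
  have hYint : ∀ s, 0 ≤ s → IntegrableOn (fun x => φ x * max (|u x| - s) 0 ^ p) Ω := fun s hs =>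
    integrableOn_weight_mul_max_rpow hp0 hΩm hφ' hφL huc hup hs
  have hYnn : ∀ s x, x ∈ Ω → 0 ≤ φ x * max (|u x| - s) 0 ^ p := fun s x hx =>
    mul_nonneg (hφ' x hx) (Real.rpow_nonneg (le_max_right _ _) _)
  have hmono : ∀ s t, 0 ≤ s → s ≤ t → Y t ≤ Y s := fun s t hs hst => by
    refine setIntegral_mono_on (hYint t (hs.trans hst)) (hYint s hs) hΩm fun x hx => ?_
    have := hφ' x hx
    have h0 : 0 ≤ max (|u x| - t) 0 := le_max_right _ _
    gcongr
  set σ : ℕ → ℝ := fun j => S * (2 - (1 / 2) ^ j) with hσ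
  have hpow : ∀ j : ℕ, 0 < ((1 : ℝ) / 2) ^ j ∧ ((1 : ℝ) / 2) ^ j ≤ 1 := fun j =>
    ⟨by positivity, pow_le_one₀ (by norm_num) (by norm_num)⟩
  have hσ0 : ∀ j, 0 < σ j := fun j => mul_pos hS0 (by linarith [hpow j])
  have hdiff : ∀ j, σ (j + 1) - σ j = S * (1 / 2) ^ (j + 1) := fun j => by
    simp only [hσ, pow_succ]; ring
  have hhalf : ∀ j : ℕ, (((1 : ℝ) / 2) ^ j) ^ p = (b ^ j)⁻¹ := fun j => by
    rw [← Real.rpow_natCast, ← Real.rpow_mul (by norm_num), mul_comm, Real.rpow_mul (by norm_num),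
      Real.rpow_natCast, one_div, Real.inv_rpow (by norm_num), inv_pow]
  have hiter : ∀ j, Y (σ j) ≤ ((b ^ (k + 1)) ^ j)⁻¹ := by
    intro j
    induction j with
    | zero =>
      rw [pow_zero, inv_one, ← hnorm]
      refine setIntegral_mono_on (hYint _ (hσ0 0).le) hup hΩm fun x hx => ?_
      have := hφ' x hx
      have h0 : 0 ≤ max (|u x| - σ 0) 0 := le_max_right _ _
      gcongr
      exact max_le (by linarith [hσ0 0]) (abs_nonneg _)
    | succ j ih =>
      have hbj : 0 < b ^ j := by positivity
      have hlt : σ j < σ (j + 1) := by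
        have : 0 < S * (1 / 2) ^ (j + 1) := by positivity
        linarith [hdiff j]
      have hτ2 : (b ^ j * Q)⁻¹ ≤ 1 / 2 := by
        rw [one_div]
        apply inv_anti₀ (by norm_num)
        have : 1 ≤ b ^ j := one_le_pow₀ (by linarith)
        nlinarith
      have hstep := setIntegral_max_rpow_step hk hp hΩ hconv hbdd hne hφ hφc hφL hcon hu
        (hσ0 j).le hlt (inv_pos.2 (mul_pos hbj hQ0)) hτ2 (by
          refine ih.trans_eq ?_
          change _ = _ * (_ * V)
          rw [hdiff, Real.mul_rpow hS0.le (by positivity), hSp, hhalf, inv_pow, mul_pow]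
          field_simp
          ring)
      have hYj : 0 ≤ Y (σ j) := setIntegral_nonneg hΩm (hYnn _)
      have hratio : (σ (j + 1) / (σ (j + 1) - σ j)) ^ p ≤ b ^ (j + 2) := by
        have h1 : σ (j + 1) / (σ (j + 1) - σ j) ≤ ((1 / 2) ^ (j + 2))⁻¹ := by
          rw [hdiff, div_le_iff₀ (by positivity)]
          have h2 : (((1 : ℝ) / 2) ^ (j + 2))⁻¹ * (S * (1 / 2) ^ (j + 1)) = S * 2 := by
            field_simp
            ring
          rw [h2]
          exact mul_le_mul_of_nonneg_left (by linarith [hpow (j + 1)]) hS0.le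
        have h3 := Real.rpow_le_rpow (div_nonneg (hσ0 _).le (by linarith)) h1 hp0.le
        rwa [Real.inv_rpow (by positivity), hhalf, inv_inv] at h3
      calc Y (σ (j + 1))
          ≤ C * (b ^ j * Q)⁻¹ * (σ (j + 1) / (σ (j + 1) - σ j)) ^ p * Y (σ j) := hstep
        _ ≤ C * (b ^ j * Q)⁻¹ * b ^ (j + 2) * ((b ^ (k + 1)) ^ j)⁻¹ := by
            gcongr
        _ = ((b ^ (k + 1)) ^ (j + 1))⁻¹ := by
            rw [hQC]
            have : C ≠ 0 := by linarith
            field_simp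
            ring
  have hlim : Tendsto (fun j : ℕ => ((b ^ (k + 1)) ^ j)⁻¹) atTop (𝓝 0) := by
    refine (tendsto_pow_atTop_atTop_of_one_lt ?_).inv_tendsto_atTop
    exact one_lt_pow₀ (by linarith) (by lia)
  have hY2 : Y (2 * S) = 0 := by
    refine le_antisymm (ge_of_tendsto' hlim fun j => ?_) (setIntegral_nonneg hΩm (hYnn _))
    refine (hmono (σ j) (2 * S) (hσ0 j).le ?_).trans (hiter j)
    have : S * (2 - (1 / 2) ^ j) ≤ S * 2 :=
      mul_le_mul_of_nonneg_left (by linarith [hpow j]) hS0.le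
    linarith
  refine ⟨2 * S, by positivity, ?_, ?_⟩
  · rw [hY] at hY2
    simp only at hY2
    rw [setIntegral_eq_zero_iff_of_nonneg_ae _ (hYint _ (by positivity))] at hY2
    · filter_upwards [hY2, ae_restrict_mem hΩm] with x hx hxΩ
      have h1 := (mul_eq_zero.1 hx).resolve_left (hφ x hxΩ).ne'
      rw [Real.rpow_eq_zero (le_max_right _ _) hp0.ne', max_eq_right_iff] at h1
      linarith
    · filter_upwards [ae_restrict_mem hΩm] with x hx using hYnn _ x hx
  · rw [Real.mul_rpow (by norm_num) hS0.le, hSp, h4, ← hb]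
    field_simp

theorem toReal_volume_unitBall_le (k : ℕ) :
    (volume (Metric.ball (0 : EuclideanSpace ℝ (Fin k)) 1)).toReal ≤ 2 ^ k := by
  have hsub : Metric.ball (0 : EuclideanSpace ℝ (Fin k)) 1 ⊆
      (WithLp.ofLp : EuclideanSpace ℝ (Fin k) → Fin k → ℝ) ⁻¹' Metric.closedBall 0 1 := by
    intro x hx
    rw [mem_ball_zero_iff] at hx
    rw [mem_preimage, mem_closedBall_zero_iff, pi_norm_le_iff_of_nonneg zero_le_one]
    exact fun i => (PiLp.norm_apply_le x i).trans hx.le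
  have hvol := measure_mono (μ := volume) hsub
  rw [(PiLp.volume_preserving_ofLp (Fin k)).measure_preimage
    Metric.isClosed_closedBall.measurableSet.nullMeasurableSet,
    Real.volume_pi_closedBall _ zero_le_one, mul_one, Fintype.card_fin] at hvol
  exact ENNReal.toReal_le_of_le_ofReal (by positivity) hvol

theorem le_Kinf {k : ℕ} (hk : 2 ≤ k) :
    2 ^ (4 * k) * ((k : ℝ) ^ (k + 1)) ^ k ≤ Kinf k := by
  have hω : 0 < (volume (Metric.ball (0 : EuclideanSpace ℝ (Fin k)) 1)).toReal :=
    ENNReal.toReal_pos (Metric.measure_ball_pos _ _ zero_lt_one).ne' measure_ball_lt_top.ne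
  have hinv := inv_anti₀ hω (toReal_volume_unitBall_le k)
  have hk0 : (0 : ℝ) < (k : ℝ) - 1 := by
    have : (2 : ℝ) ≤ k := by exact_mod_cast hk
    linarith
  have hbern : (2 : ℝ) ^ k ≤ ((k : ℝ) / ((k : ℝ) - 1)) ^ (k * (k - 1)) := by
    rw [mul_comm, pow_mul]
    refine pow_le_pow_left₀ zero_le_two ?_ k
    have h := one_add_mul_le_pow (a := 1 / ((k : ℝ) - 1))
      ((by norm_num : (-2 : ℝ) ≤ 0).trans (by positivity)) (k - 1)
    rw [Nat.cast_sub (by lia), Nat.cast_one, mul_one_div_cancel hk0.ne'] at h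
    have heq : (k : ℝ) / ((k : ℝ) - 1) = 1 + 1 / ((k : ℝ) - 1) := by
      field_simp
      ring
    rw [heq]
    linarith
  have hmid : (4 * (k : ℝ) ^ (k + 1)) ^ k ≤ (1 + 4 * (k : ℝ) ^ (k + 1)) ^ k :=
    pow_le_pow_left₀ (by positivity) (by linarith) k
  calc 2 ^ (4 * k) * ((k : ℝ) ^ (k + 1)) ^ k
      = 2 ^ (2 * k) * (2 ^ k)⁻¹ * (4 * (k : ℝ) ^ (k + 1)) ^ k * 2 ^ k := by
        have h4 : (4 : ℝ) ^ k = 2 ^ (2 * k) := by rw [pow_mul]; norm_num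
        rw [mul_pow, h4]
        field_simp
        ring
    _ ≤ Kinf k := by
        unfold Kinf
        gcongr

theorem deGiorgiConst_mul_le {p : ℝ} (hp : 1 < p) {k : ℕ} (hk : 2 ≤ k) :
    deGiorgiConst p k * 2 ^ p ≤
      ((2 : ℝ) ^ p) ^ 4 * ((k : ℝ) ^ p) ^ (k + 1) * Kkroger p k := by
  have hp0 : 0 < p := by linarith
  have hk0 : (0 : ℝ) < k := by positivity
  obtain ⟨b, hb⟩ : ∃ b, b = (2 : ℝ) ^ p := ⟨_, rfl⟩
  obtain ⟨κ, hκ⟩ : ∃ κ, κ = (k : ℝ) ^ p := ⟨_, rfl⟩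
  obtain ⟨X, hX⟩ : ∃ X, X = (2 : ℝ) ^ (((k : ℝ) + 3 * p) / 2) := ⟨_, rfl⟩
  have hb2 : 2 ≤ b := hb ▸ Real.self_le_rpow_of_one_le one_le_two hp.le
  have hb0 : 0 < b := by linarith
  have hκ0 : 0 < κ := hκ ▸ Real.rpow_pos_of_pos hk0 p
  have hX0 : 0 < X := hX ▸ Real.rpow_pos_of_pos two_pos _
  have hXsq : X ^ 2 = 2 ^ k * b ^ 3 := by
    rw [hX, hb, ← Real.rpow_natCast, ← Real.rpow_natCast, ← Real.rpow_natCast,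
      ← Real.rpow_mul zero_le_two, ← Real.rpow_mul zero_le_two, ← Real.rpow_add two_pos]
    congr 1
    push_cast
    ring
  have hkr : Kkroger p k = (p + 1) * X * ((k : ℝ) ^ k * κ) := by
    rw [Kkroger, Real.rpow_add hk0, Real.rpow_natCast, ← hX, ← hκ]
  have h4 : (4 : ℝ) ^ p = b ^ 2 := by
    rw [hb, ← Real.rpow_natCast, ← Real.rpow_mul zero_le_two, mul_comm,
      Real.rpow_mul zero_le_two]
    norm_num
  rw [hkr, deGiorgiConst, h4, ← hb, ← hκ]
  refine (sq_le_sq₀ (by positivity) (by positivity)).1 ?_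
  have hl : (4 / 3 * 2 ^ k * p * (2 ^ k * b ^ 2) * b ^ (k + 3) * b) ^ 2
      = 16 / 9 * p ^ 2 * 16 ^ k * b ^ (2 * k + 12) := by
    have : (16 : ℝ) ^ k = (2 ^ k) ^ 4 := by
      rw [← pow_mul, mul_comm, pow_mul]; norm_num
    rw [this]
    ring
  have hr : (b ^ 4 * κ ^ (k + 1) * ((p + 1) * X * ((k : ℝ) ^ k * κ))) ^ 2
      = b ^ 8 * (κ ^ 2) ^ (k + 2) * (p + 1) ^ 2 * (2 ^ k * b ^ 3) * ((k : ℝ) ^ 2) ^ k := by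
    rw [← hXsq]
    ring
  rw [hl, hr]
  have hpp : p ^ 2 ≤ (p + 1) ^ 2 := by nlinarith
  rcases hk.eq_or_lt with rfl | hk3
  · have hκb : κ = b := by rw [hκ, hb]; norm_num
    have hb3 : (2 : ℝ) ^ 3 ≤ b ^ 3 := pow_le_pow_left₀ zero_le_two hb2 3
    rw [hκb]
    calc 16 / 9 * p ^ 2 * 16 ^ 2 * b ^ (2 * 2 + 12)
        ≤ 64 * (2 ^ 3 * (p + 1) ^ 2) * b ^ 16 := by
          refine mul_le_mul_of_nonneg_right ?_ (by positivity)
          linarith [sq_nonneg p]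
      _ ≤ 64 * (b ^ 3 * (p + 1) ^ 2) * b ^ 16 := by gcongr
      _ = _ := by push_cast; ring
  · have hk8 : (8 : ℝ) ≤ (k : ℝ) ^ 2 := by
      have : (3 : ℝ) ≤ k := by exact_mod_cast hk3
      nlinarith
    have hκ3 : b ^ 3 ≤ κ ^ 2 := by
      have h := Real.rpow_le_rpow (by norm_num) hk8 hp0.le
      have h8 : (8 : ℝ) ^ p = b ^ 3 := by
        rw [hb, ← Real.rpow_natCast, ← Real.rpow_mul zero_le_two, mul_comm,
          Real.rpow_mul zero_le_two]
        norm_num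
      have hk2 : ((k : ℝ) ^ 2) ^ p = κ ^ 2 := by
        rw [hκ, ← Real.rpow_natCast, ← Real.rpow_natCast, ← Real.rpow_mul hk0.le,
          ← Real.rpow_mul hk0.le, mul_comm]
      rwa [h8, hk2] at h
    have hbk : 16 / 9 ≤ b ^ (k + 5) :=
      (by linarith : 16 / 9 ≤ b).trans (le_self_pow₀ (by linarith) (by lia))
    calc 16 / 9 * p ^ 2 * 16 ^ k * b ^ (2 * k + 12)
        ≤ b ^ (k + 5) * (p + 1) ^ 2 * 16 ^ k * b ^ (2 * k + 12) := by gcongr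
      _ = b ^ 8 * (b ^ 3) ^ (k + 2) * (p + 1) ^ 2 * (2 ^ k * b ^ 3) * 8 ^ k := by
          have : (16 : ℝ) ^ k = 2 ^ k * 8 ^ k := by rw [← mul_pow]; norm_num
          rw [this]
          ring
      _ ≤ _ := by gcongr

theorem four_rpow_mul_deGiorgiConst_pow_le {p : ℝ} (hp : 1 < p) {k : ℕ} (hk : 2 ≤ k) :
    4 ^ p * deGiorgiConst p k ^ k ≤ Kinf k ^ p * Kkroger p k ^ k := by
  have hp0 : 0 < p := by linarith
  have hb1 : (1 : ℝ) ≤ 2 ^ p := Real.one_le_rpow one_le_two hp0.le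
  have hQ : 0 ≤ deGiorgiConst p k := by unfold deGiorgiConst; positivity
  have hK : 0 ≤ Kkroger p k := by unfold Kkroger; positivity
  have h4 : (4 : ℝ) ^ p = ((2 : ℝ) ^ p) ^ 2 := by
    rw [← Real.rpow_natCast, ← Real.rpow_mul zero_le_two, mul_comm, Real.rpow_mul zero_le_two]
    norm_num
  have hinf : (((2 : ℝ) ^ p) ^ 4 * ((k : ℝ) ^ p) ^ (k + 1)) ^ k ≤ Kinf k ^ p := by
    refine le_of_eq_of_le ?_ (Real.rpow_le_rpow (by positivity) (le_Kinf hk) hp0.le)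
    rw [pow_mul, ← mul_pow, ← Real.rpow_pow_comm (by positivity),
      Real.mul_rpow (by positivity) (by positivity), ← Real.rpow_pow_comm (by positivity),
      ← Real.rpow_pow_comm (by positivity)]
  calc 4 ^ p * deGiorgiConst p k ^ k
      ≤ ((2 : ℝ) ^ p) ^ k * deGiorgiConst p k ^ k := by
        rw [h4]
        gcongr
    _ = (deGiorgiConst p k * 2 ^ p) ^ k := by rw [mul_pow, mul_comm]
    _ ≤ (((2 : ℝ) ^ p) ^ 4 * ((k : ℝ) ^ p) ^ (k + 1) * Kkroger p k) ^ k :=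
        pow_le_pow_left₀ (by positivity) (deGiorgiConst_mul_le hp hk) k
    _ ≤ Kinf k ^ p * Kkroger p k ^ k := by
        rw [mul_pow]
        gcongr

theorem IsAlphaConcaveOn.mul_volume_le {N m : ℕ} (hm : 0 < m)
    {Ω : Set (EuclideanSpace ℝ (Fin N))} (hΩ : IsOpen Ω) (hconv : Convex ℝ Ω)
    {φ : EuclideanSpace ℝ (Fin N) → ℝ}
    (hφ : IsAlphaConcaveOn (1 / m) Ω φ) (hφL : IntegrableOn φ Ω)
    {x : EuclideanSpace ℝ (Fin N)} (hx : x ∈ Ω) :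
    φ x * (volume Ω).toReal ≤ 2 ^ (N + m) * ∫ y in Ω, φ y := by
  have hΩm := hΩ.measurableSet
  have hF := measurable_indicator_ofReal hΩ (hφ.continuousOn hm hΩ)
  have hscale := lintegral_comp_add_smul ((1 / 2 : ℝ) • x) (by norm_num : (0 : ℝ) < 1 / 2) hF
  have hlow : ENNReal.ofReal ((1 / 2) ^ m * φ x) * volume Ω ≤
      ∫⁻ y, Ω.indicator (fun x => ENNReal.ofReal (φ x)) ((1 / 2 : ℝ) • x + (1 / 2 : ℝ) • y) := by
    rw [← setLIntegral_const]
    refine (setLIntegral_mono' hΩm fun y hy => ?_).trans (setLIntegral_le_lintegral Ω _)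
    have hmem : (1 / 2 : ℝ) • x + (1 / 2 : ℝ) • y ∈ Ω :=
      hconv hx hy (by norm_num) (by norm_num) (by norm_num)
    rw [indicator_of_mem hmem]
    refine ENNReal.ofReal_le_ofReal ((hφ.pow_mul_le hm hy hx (t := 1 / 2) (by norm_num)
      (by norm_num)).trans_eq ?_)
    congr 1
    module
  rw [hscale, lintegral_indicator hΩm, ← ofReal_integral_eq_lintegral_ofReal hφL
    ((ae_restrict_mem hΩm).mono fun y hy => (hφ.1 y hy).le),
    ← ENNReal.ofReal_mul (by positivity)] at hlow
  have hV : 0 ≤ ∫ y in Ω, φ y := setIntegral_nonneg hΩm fun y hy => (hφ.1 y hy).le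
  have hreal := ENNReal.toReal_le_of_le_ofReal (by positivity) hlow
  have hφx := hφ.1 x hx
  rw [ENNReal.toReal_mul, ENNReal.toReal_ofReal (by positivity)] at hreal
  have h2 := mul_le_mul_of_nonneg_left hreal (by positivity : (0 : ℝ) ≤ 2 ^ m)
  have e1 : (2 : ℝ) ^ m * ((1 / 2) ^ m * φ x * (volume Ω).toReal)
      = φ x * (volume Ω).toReal := by
    rw [one_div, inv_pow]
    field_simp
  have e2 : (2 : ℝ) ^ m * (((1 / 2) ^ N)⁻¹ * ∫ y in Ω, φ y)
      = 2 ^ (N + m) * ∫ y in Ω, φ y := by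
    rw [one_div, inv_pow, inv_inv, pow_add]
    ring
  rwa [e1, e2] at h2

/-- Proposition 4.8, area control for the cells: if `ū` is a first
eigenfunction for `μ_p(Ω,φ)` normalized in `L^p(Ω,φ)`, every cell `ω` of a `φ`-weighted
`L^p` equipartition of `ū` in `Ω` into `n` cells satisfies `|ω| ≥ K₂ |Ω| / n`. -/
theorem stmt13 (p : ℝ) (hp : 1 < p) (N m : ℕ) (hN : 1 ≤ N) (hm : 0 < m)
    (Ω : Set (EuclideanSpace ℝ (Fin N)))
    (hopen : IsOpen Ω) (hconv : Convex ℝ Ω) (hbdd : Bornology.IsBounded Ω) (hne : Ω.Nonempty)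
    (φ : EuclideanSpace ℝ (Fin N) → ℝ)
    (hφint : IntegrableOn φ Ω volume)
    (hφ : IsAlphaConcaveOn (1 / m) Ω φ)
    (u : EuclideanSpace ℝ (Fin N) → ℝ)
    (hu : IsFirstEigenfunction p Ω φ u)
    (hnorm : (∫ x in Ω, φ x * |u x| ^ p) = 1)
    (n : ℕ) (hn : 0 < n) (P : Fin n → Set (EuclideanSpace ℝ (Fin N)))
    (hP : IsLpEquipartition p Ω φ u n P) :
    ∀ i, (volume (P i)).toReal ≥ K2 p (N + m) * (volume Ω).toReal / n := by
  intro i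
  obtain ⟨hPo, -, hPΩ, -, -, -, hPp⟩ := hP
  have hΩm := hopen.measurableSet
  have hk : 2 ≤ N + m := by lia
  have hV : 0 < ∫ x in Ω, φ x := by
    rw [setIntegral_pos_iff_support_of_nonneg_ae
      ((ae_restrict_mem hΩm).mono fun y hy => (hφ.1 y hy).le) hφint]
    exact (hopen.measure_pos volume hne).trans_le
      (measure_mono fun y hy => ⟨(hφ.1 y hy).ne', hy⟩)
  have hvol : 0 < (volume Ω).toReal :=
    ENNReal.toReal_pos (hopen.measure_pos volume hne).ne' hbdd.measure_lt_top.ne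
  obtain ⟨M, hM0, hM, hMV⟩ := hu.exists_ae_abs_le hk hp hopen hconv hbdd hne hφ.1
    (hφ.continuousOn hm hopen) hφint (hasContraction_weightedMeasure hm hopen hconv hφ) hnorm hV
  have hD := four_rpow_mul_deGiorgiConst_pow_le hp hk
  have hW : 0 < (4 : ℝ) ^ p * deGiorgiConst p (N + m) ^ (N + m) := by
    unfold deGiorgiConst
    positivity
  rw [← hMV] at hD hW
  set V := ∫ x in Ω, φ x
  set D := Kinf (N + m) ^ p * Kkroger p (N + m) ^ (N + m) with hDdef
  have hD0 : 0 < D := hW.trans_le hD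
  have hcell : (1 / n : ℝ) ≤
      2 ^ (N + m) * V / (volume Ω).toReal * M ^ p * (volume (P i)).toReal := by
    have h := hPp i
    rw [hnorm, mul_one] at h
    have hfin : volume (P i) < ∞ := (measure_mono (hPΩ i)).trans_lt hbdd.measure_lt_top
    have hle : ∫ x in P i, φ x * |u x| ^ p ≤
        ∫ _ in P i, 2 ^ (N + m) * V / (volume Ω).toReal * M ^ p := by
      refine integral_mono_ae (hu.2.2.1.mono_set (hPΩ i))
        (integrableOn_const hfin.ne) ?_
      filter_upwards [ae_restrict_of_ae_restrict_of_subset (hPΩ i) hM,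
        ae_restrict_mem (hPo i).measurableSet] with x hx hxP
      refine mul_le_mul ?_ (Real.rpow_le_rpow (abs_nonneg _) hx (by linarith))
        (Real.rpow_nonneg (abs_nonneg _) _) (by positivity)
      rw [le_div_iff₀ hvol]
      exact hφ.mul_volume_le hm hopen hconv hφint (hPΩ i hxP)
    rw [h, setIntegral_const, smul_eq_mul, mul_comm, measureReal_def] at hle
    exact hle
  have hn0 : (0 : ℝ) < n := by exact_mod_cast hn
  have hfinal : (1 / n : ℝ) ≤ 2 ^ (N + m) * D / (volume Ω).toReal * (volume (P i)).toReal :=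
    calc (1 / n : ℝ) ≤ 2 ^ (N + m) * V / (volume Ω).toReal * M ^ p * (volume (P i)).toReal := hcell
      _ = 2 ^ (N + m) * (M ^ p * V) / (volume Ω).toReal * (volume (P i)).toReal := by ring
      _ ≤ _ := by gcongr
  have hK : K2 p (N + m) = 1 / 2 ^ (N + m) / D := rfl
  rw [hK, ge_iff_le, div_le_iff₀ hn0, div_div, one_div, inv_mul_le_iff₀ (by positivity)]
  have h1 := mul_le_mul_of_nonneg_left hfinal (mul_pos hvol hn0).le
  have e1 : (volume Ω).toReal * n * (1 / n) = (volume Ω).toReal := by field_simp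
  have e2 : (volume Ω).toReal * n *
      (2 ^ (N + m) * D / (volume Ω).toReal * (volume (P i)).toReal)
      = 2 ^ (N + m) * D * ((volume (P i)).toReal * n) := by field_simp
  rwa [e1, e2] at h1
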